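/- arXiv:1301.4121 — 3 statements merged into one kernel-verified Lean document; each statement's English description precedes it below -/
import Mathlib

section
/- Let n ≥ 1 and let C be a class of n-vertex simple graphs closed under isomorphism. Suppose that for every G ∈ C, every n-vertex simple graph H ∉ C, and every reconstruction G' of G, s(H, G') = s(H, G). Then C satisfies Kocay's lemma: for every finite sequence 𝓕 = (F_1, …, F_m) of simple graphs, each with fewer than n vertices, and all G, G' ∈ C with G' a reconstruction of G, Σ_{H ∈ C/≅} c(𝓕, H) · s(H, G') = Σ_{H ∈ C/≅} c(𝓕, H) · s(H, G), where the sums are over the isomorphism classes of graphs in C. -/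
open SimpleGraph

/-- The vertex-deleted subgraph `G − v`: the induced subgraph of `G` obtained by
deleting `v` and all edges incident with `v`. -/
abbrev vdel {n : ℕ} (G : SimpleGraph (Fin n)) (v : Fin n) :
    SimpleGraph ({v}ᶜ : Set (Fin n)) :=
  G.induce {v}ᶜ

/-- `H` is a reconstruction of `G`: there is a bijection `f` between the vertex
sets such that `G − v ≅ H − f v` for every vertex `v`. -/
def IsReconstruction {n : ℕ} (G H : SimpleGraph (Fin n)) : Prop :=
  ∃ f : Fin n ≃ Fin n, ∀ v : Fin n, Nonempty (vdel G v ≃g vdel H (f v))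

/-- `s(F,G)`: the number of subgraphs of `G` isomorphic to `F`. -/
noncomputable def subCount {k n : ℕ} (F : SimpleGraph (Fin k))
    (G : SimpleGraph (Fin n)) : ℕ :=
  Nat.card {H : G.Subgraph // Nonempty (F ≃g H.coe)}

/-- A finite sequence of simple graphs (on arbitrary finite vertex sets). -/
abbrev GSeq : Type := List (Σ k : ℕ, SimpleGraph (Fin k))

/-- `c(𝓕,G)`: the number of covers of `G` by the sequence `L`, i.e. of sequences
of subgraphs of `G`, the `i`-th being isomorphic to the `i`-th graph of `L`,
whose union (of both vertex sets and edge sets) is all of `G`. -/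
noncomputable def coverCount {n : ℕ} (L : GSeq) (G : SimpleGraph (Fin n)) : ℕ :=
  Nat.card {C : Fin L.length → G.Subgraph //
    (∀ i, Nonempty ((L.get i).2 ≃g (C i).coe)) ∧ (⨆ i, C i) = ⊤}

/-- `R` is a transversal of the isomorphism classes of graphs in `C`:
it contains exactly one representative of each isomorphism class in `C`. -/
def IsIsoTransversal {n : ℕ} (C : Set (SimpleGraph (Fin n)))
    (R : Finset (SimpleGraph (Fin n))) : Prop :=
  ↑R ⊆ C ∧ ∀ G ∈ C, ∃! H, H ∈ R ∧ Nonempty (G ≃g H)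

/-- `D` is a transversal of the reconstruction classes of graphs in `C`:
it contains exactly one representative of each `∼`-equivalence class in `C`. -/
def IsReconTransversal {n : ℕ} (C : Set (SimpleGraph (Fin n)))
    (D : Finset (SimpleGraph (Fin n))) : Prop :=
  ↑D ⊆ C ∧ ∀ G ∈ C, ∃! H, H ∈ D ∧ IsReconstruction G H


section Helpers

/-- Tuples of subgraphs with prescribed isomorphism types, whose union satisfies `P`. -/
def Tup {ι V : Type} (F : ι → Σ k : ℕ, SimpleGraph (Fin k)) (G : SimpleGraph V)
    (P : G.Subgraph → Prop) : Set (ι → G.Subgraph) :=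
  {C | (∀ i, Nonempty ((F i).2 ≃g (C i).coe)) ∧ P (⨆ i, C i)}

theorem mem_tup {ι V : Type} (F : ι → Σ k : ℕ, SimpleGraph (Fin k)) (G : SimpleGraph V)
    (P : G.Subgraph → Prop) (C : ι → G.Subgraph) :
    C ∈ Tup F G P ↔ (∀ i, Nonempty ((F i).2 ≃g (C i).coe)) ∧ P (⨆ i, C i) := Iff.rfl

/-- The image of a subgraph under an injective homomorphism is isomorphic to it. -/
noncomputable def mapIsoOfInj {V W : Type} {G : SimpleGraph V} {G' : SimpleGraph W}
    (f : G →g G') (hf : Function.Injective f) (H : G.Subgraph) :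
    H.coe ≃g (H.map f).coe where
  toEquiv := Equiv.Set.image f H.verts hf
  map_rel_iff' := by
    intro a b
    change Relation.Map H.Adj f f (f a) (f b) ↔ H.Adj a b
    simp [Relation.Map, hf.eq_iff]

theorem sg_map_inj {V W : Type} {G : SimpleGraph V} {G' : SimpleGraph W}
    (f : G →g G') (hf : Function.Injective f) :
    Function.Injective (Subgraph.map f : G.Subgraph → G'.Subgraph) := by
  intro A B h
  have h1 : f '' A.verts = f '' B.verts := congrArg Subgraph.verts h
  have h2 : ∀ a b, Relation.Map A.Adj f f a b ↔ Relation.Map B.Adj f f a b := by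
    intro a b
    exact iff_of_eq (congrArg (fun H : G'.Subgraph => H.Adj a b) h)
  ext a b
  · rw [hf.image_injective h1]
  · have := h2 (f a) (f b)
    simpa [Relation.Map, hf.eq_iff] using this

theorem sg_map_iSup {ι V W : Type} {G : SimpleGraph V} {G' : SimpleGraph W}
    (f : G →g G') (C : ι → G.Subgraph) :
    (⨆ i, C i).map f = ⨆ i, (C i).map f := by
  ext a b
  · simp only [Subgraph.map_verts, Subgraph.verts_iSup, Set.image_iUnion]
  · simp only [Subgraph.map_adj, Subgraph.iSup_adj, Relation.Map]
    grind

theorem sg_map_comap {V W : Type} {G : SimpleGraph V} {G' : SimpleGraph W}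
    (f : G →g G') (hf : Function.Injective f) (H : G'.Subgraph)
    (h : H ≤ Subgraph.map f ⊤) : (H.comap f).map f = H := by
  apply le_antisymm
  · rw [Subgraph.map_le_iff_le_comap]
  · constructor
    · intro v hv
      obtain ⟨w, -, rfl⟩ := h.1 hv
      exact ⟨w, hv, rfl⟩
    · intro a b hab
      obtain ⟨x, y, hxy, rfl, rfl⟩ := h.2 hab
      exact ⟨x, y, ⟨by simpa using hxy, hab⟩, rfl, rfl⟩

theorem tup_map {ι V W : Type} (F : ι → Σ k : ℕ, SimpleGraph (Fin k))
    {G : SimpleGraph V} {G' : SimpleGraph W}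
    (f : G →g G') (hf : Function.Injective f) (P : G.Subgraph → Prop)
    (Q : G'.Subgraph → Prop) (hPQ : ∀ H, P H ↔ Q (H.map f)) :
    (Tup F G P).ncard = (Tup F G' (fun H => Q H ∧ H ≤ Subgraph.map f ⊤)).ncard := by
  have hinj : Function.Injective (fun (C : ι → G.Subgraph) i => (C i).map f) := by
    intro A B h
    funext i
    exact sg_map_inj f hf (congrFun h i)
  rw [← Set.ncard_image_of_injective _ hinj]
  congr 1
  ext D
  constructor
  · rintro ⟨C, ⟨h1, h2⟩, rfl⟩
    refine ⟨fun i => ⟨(h1 i).some.trans (mapIsoOfInj f hf _)⟩, ?_⟩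
    dsimp only
    rw [← sg_map_iSup]
    exact ⟨(hPQ _).1 h2, Subgraph.map_mono le_top⟩
  · rintro ⟨h1, h2, h3⟩
    have h4 : ∀ i, ((D i).comap f).map f = D i := fun i =>
      sg_map_comap f hf _ ((le_iSup D i).trans h3)
    refine ⟨fun i => (D i).comap f, ⟨fun i => ?_, ?_⟩, funext h4⟩
    · have e := mapIsoOfInj f hf ((D i).comap f)
      have e1 := (h1 i).some
      rw [← h4 i] at e1
      exact ⟨e1.trans e.symm⟩
    · rw [hPQ, sg_map_iSup]
      simpa only [h4] using h2

theorem tup_iso {ι V W : Type} (F : ι → Σ k : ℕ, SimpleGraph (Fin k))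
    {G : SimpleGraph V} {G' : SimpleGraph W} (e : G ≃g G') (k : ℕ) :
    (Tup F G (fun H => H.verts.ncard = k)).ncard =
      (Tup F G' (fun H => H.verts.ncard = k)).ncard := by
  rw [tup_map F e.toHom e.injective _ (fun H => H.verts.ncard = k)]
  · simp only [Subgraph.map_iso_top, le_top, and_true]
  · intro H
    rw [Subgraph.map_verts, Set.ncard_image_of_injective (f := e.toHom) _ e.injective]

theorem tup_vdel {ι : Type} {n : ℕ} (F : ι → Σ k : ℕ, SimpleGraph (Fin k))
    (G : SimpleGraph (Fin n)) (v : Fin n) (k : ℕ) :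
    (Tup F (vdel G v) (fun H => H.verts.ncard = k)).ncard =
      (Tup F G (fun H => H.verts.ncard = k ∧ v ∉ H.verts)).ncard := by
  have hi : Function.Injective (Embedding.induce (G := G) ({v}ᶜ : Set (Fin n))).toHom :=
    Subtype.val_injective
  rw [tup_map F _ hi _ (fun H => H.verts.ncard = k)]
  · congr 2
    funext H
    apply propext
    apply and_congr_right
    intro _
    constructor
    · intro h hv
      obtain ⟨w, -, hw⟩ := h.1 hv
      exact w.2 hw
    · intro hv
      have hne : ∀ w ∈ H.verts, w ∈ ({v}ᶜ : Set (Fin n)) := by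
        rintro w hw rfl
        exact hv hw
      constructor
      · intro w hw
        exact ⟨⟨w, hne w hw⟩, trivial, rfl⟩
      · intro a b hab
        refine ⟨⟨a, hne a (H.edge_vert hab)⟩, ⟨b, hne b (H.edge_vert hab.symm)⟩, ?_, rfl, rfl⟩
        simpa using H.adj_sub hab
  · intro H
    rw [Subgraph.map_verts, Set.ncard_image_of_injective _ hi]

open Classical in
theorem kelly {ι : Type} [Finite ι] {n : ℕ} (F : ι → Σ k : ℕ, SimpleGraph (Fin k))
    (G : SimpleGraph (Fin n)) (k : ℕ) :
    ∑ v, (Tup F (vdel G v) (fun H => H.verts.ncard = k)).ncard =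
      (n - k) * (Tup F G (fun H => H.verts.ncard = k)).ncard := by
  have := Fintype.ofFinite (ι → G.Subgraph)
  simp_rw [tup_vdel]
  set S : Finset (ι → G.Subgraph) := (Tup F G (fun H => H.verts.ncard = k)).toFinset with hS
  have h1 : ∀ v, (Tup F G (fun H => H.verts.ncard = k ∧ v ∉ H.verts)).ncard =
      ∑ C ∈ S, if v ∉ (⨆ i, C i).verts then 1 else 0 := by
    intro v
    rw [Set.ncard_eq_toFinset_card', ← Finset.card_filter]
    congr 1
    ext C
    simp only [hS, Finset.mem_filter, Set.mem_toFinset, mem_tup, and_assoc]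
  simp_rw [h1]
  rw [Finset.sum_comm, Set.ncard_eq_toFinset_card', mul_comm, ← hS, ← smul_eq_mul,
    ← Finset.sum_const]
  apply Finset.sum_congr rfl
  intro C hC
  have hC' : (⨆ i, C i).verts.ncard = k := by
    rw [hS, Set.mem_toFinset] at hC
    exact hC.2
  rw [← hC', ← Finset.card_filter,
    Set.ncard_eq_toFinset_card']
  have hc := Finset.card_compl (⨆ i, C i).verts.toFinset
  rw [Fintype.card_fin] at hc
  rw [← hc]
  congr 1
  ext v
  simp

theorem tup_recon {ι : Type} [Finite ι] {n : ℕ} (F : ι → Σ k : ℕ, SimpleGraph (Fin k))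
    (G G' : SimpleGraph (Fin n)) (h : IsReconstruction G G') (k : ℕ) (hk : k < n) :
    (Tup F G' (fun H => H.verts.ncard = k)).ncard =
      (Tup F G (fun H => H.verts.ncard = k)).ncard := by
  obtain ⟨f, hf⟩ := h
  have h0 : 0 < n - k := by omega
  apply Nat.eq_of_mul_eq_mul_left h0
  rw [← kelly, ← kelly, ← Equiv.sum_comp f]
  apply Finset.sum_congr rfl
  intro v _
  exact (tup_iso F (hf v).some k).symm

theorem single_recon {n : ℕ} (F : Σ k : ℕ, SimpleGraph (Fin k)) (hF : F.1 < n)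
    (G G' : SimpleGraph (Fin n)) (h : IsReconstruction G G') :
    Nat.card {H : G'.Subgraph // Nonempty (F.2 ≃g H.coe)} =
      Nat.card {H : G.Subgraph // Nonempty (F.2 ≃g H.coe)} := by
  have key : ∀ G : SimpleGraph (Fin n),
      Nat.card {H : G.Subgraph // Nonempty (F.2 ≃g H.coe)} =
      (Tup (fun _ : Unit => F) G (fun H => H.verts.ncard = F.1)).ncard := by
    intro G
    rw [← Nat.card_coe_set_eq]
    apply Nat.card_congr
    refine (Equiv.subtypeEquiv (Equiv.funUnique Unit _) ?_).symm
    intro C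
    have hu : (⨆ i, C i) = C () := by
      rw [iSup_unique]
    show ((∀ i : Unit, Nonempty (F.2 ≃g (C i).coe)) ∧ (⨆ i, C i).verts.ncard = F.1) ↔ 
      Nonempty (F.2 ≃g (C ()).coe)
    rw [hu]
    constructor
    · intro h
      exact h.1 ()
    · intro h
      refine ⟨fun _ => h, ?_⟩
      rw [← Nat.card_coe_set_eq, ← Nat.card_congr h.some.toEquiv, Nat.card_fin]
  rw [key, key]
  exact tup_recon _ G G' h _ hF

theorem total_recon {n : ℕ} (L : GSeq) (hL : ∀ F ∈ L, F.1 < n)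
    (G G' : SimpleGraph (Fin n)) (h : IsReconstruction G G') :
    (Tup L.get G' (fun _ => True)).ncard = (Tup L.get G (fun _ => True)).ncard := by
  have key : ∀ G : SimpleGraph (Fin n), (Tup L.get G (fun _ => True)).ncard =
      ∏ i, Nat.card {H : G.Subgraph // Nonempty ((L.get i).2 ≃g H.coe)} := by
    intro G
    rw [← Nat.card_pi, ← Nat.card_coe_set_eq]
    apply Nat.card_congr
    refine Equiv.trans (Equiv.subtypeEquivRight ?_)
      (Equiv.subtypePiEquivPi (p := fun i (H : G.Subgraph) => Nonempty ((L.get i).2 ≃g H.coe)))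
    intro C
    exact and_iff_left trivial
  rw [key, key]
  apply Finset.prod_congr rfl
  intro i _
  exact single_recon _ (hL _ (List.get_mem _ _)) G G' h

open Classical in
theorem total_eq {ι : Type} [Finite ι] {n : ℕ} (F : ι → Σ k : ℕ, SimpleGraph (Fin k))
    (G : SimpleGraph (Fin n)) :
    (Tup F G (fun _ => True)).ncard =
      ∑ k ∈ Finset.range (n + 1), (Tup F G (fun H => H.verts.ncard = k)).ncard := by
  have := Fintype.ofFinite (ι → G.Subgraph)
  rw [Set.ncard_eq_toFinset_card',
    Finset.card_eq_sum_card_fiberwise (f := fun C => (⨆ i, C i).verts.ncard)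
      (t := Finset.range (n + 1))]
  · apply Finset.sum_congr rfl
    intro k _
    rw [Set.ncard_eq_toFinset_card']
    congr 1
    ext C
    simp only [Finset.mem_filter, Set.mem_toFinset, mem_tup, and_true]
  · intro C _
    have := Set.ncard_le_card (⨆ i, C i).verts
    simp at this ⊢
    omega

theorem span_recon {n : ℕ} (L : GSeq) (hL : ∀ F ∈ L, F.1 < n)
    (G G' : SimpleGraph (Fin n)) (h : IsReconstruction G G') :
    (Tup L.get G' (fun H => H.verts.ncard = n)).ncard =
      (Tup L.get G (fun H => H.verts.ncard = n)).ncard := by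
  have h1 := total_recon L hL G G' h
  rw [total_eq, total_eq, Finset.sum_range_succ, Finset.sum_range_succ,
    Finset.sum_congr rfl (fun k hk => tup_recon L.get G G' h k (Finset.mem_range.1 hk))] at h1
  exact Nat.add_left_cancel h1

theorem cover_eq {n : ℕ} (L : GSeq) (K : SimpleGraph (Fin n)) :
    coverCount L K = (Tup L.get K (fun H => H = ⊤)).ncard := by
  rw [← Nat.card_coe_set_eq]
  rfl

theorem cover_iso {n : ℕ} (L : GSeq) (K H : SimpleGraph (Fin n)) (e : K ≃g H) :
    coverCount L K = coverCount L H := by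
  rw [cover_eq, cover_eq, tup_map L.get e.toHom e.injective _ (fun H => H = ⊤)]
  · simp only [Subgraph.map_iso_top, le_top, and_true]
  · intro A
    constructor
    · rintro rfl
      exact Subgraph.map_iso_top e
    · intro h
      apply sg_map_inj e.toHom e.injective
      rw [h, Subgraph.map_iso_top]

theorem cover_le {n : ℕ} (L : GSeq) (K G : SimpleGraph (Fin n)) (h : K ≤ G) :
    coverCount L K = (Tup L.get G (fun H => H = toSubgraph K h)).ncard := by
  have hi : Function.Injective (Hom.ofLE h) := fun _ _ h => h
  have ht : Subgraph.map (Hom.ofLE h) ⊤ = toSubgraph K h := by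
    ext a b
    · simp
    · simp [Relation.Map]
  rw [cover_eq, tup_map L.get (Hom.ofLE h) hi _ (fun H => H = toSubgraph K h)]
  · congr 2
    funext H
    apply propext
    rw [ht]
    exact ⟨fun h => h.1, fun h => ⟨h, h.le⟩⟩
  · intro A
    rw [← ht]
    exact (sg_map_inj _ hi).eq_iff.symm

theorem spanning_of_ncard {n : ℕ} {G : SimpleGraph (Fin n)} (H : G.Subgraph) :
    H.verts.ncard = n ↔ H.IsSpanning := by
  rw [Subgraph.isSpanning_iff]
  constructor
  · intro h
    apply Set.eq_of_subset_of_ncard_le (Set.subset_univ _)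
    simp [h]
  · intro h
    simp [h]

theorem toSubgraph_spanningCoe {n : ℕ} {G : SimpleGraph (Fin n)} (H : G.Subgraph)
    (h : H.IsSpanning) : toSubgraph H.spanningCoe H.spanningCoe_le = H := by
  ext a b
  · simp [h a]
  · simp

open Classical in
theorem span_eq {n : ℕ} (L : GSeq) (G : SimpleGraph (Fin n)) :
    (Tup L.get G (fun H => H.verts.ncard = n)).ncard =
      ∑ K : SimpleGraph (Fin n) with K ≤ G, coverCount L K := by
  have := Fintype.ofFinite (Fin L.length → G.Subgraph)
  rw [Set.ncard_eq_toFinset_card',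
    Finset.card_eq_sum_card_fiberwise (f := fun C => (⨆ i, C i).spanningCoe)
      (t := Finset.univ.filter (· ≤ G))]
  · apply Finset.sum_congr rfl
    intro K hK
    rw [cover_le L K G (by simpa using hK), Set.ncard_eq_toFinset_card']
    congr 1
    ext C
    simp only [Finset.mem_filter, Set.mem_toFinset, mem_tup, spanning_of_ncard,
      and_assoc]
    apply and_congr_right
    intro _
    constructor
    · rintro ⟨h1, rfl⟩
      exact (toSubgraph_spanningCoe _ h1).symm
    · intro h
      rw [h]
      exact ⟨toSubgraph.isSpanning _ _, rfl⟩
  · intro C _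
    simpa using (⨆ i, C i).spanningCoe_le

open Classical in
theorem sub_eq {n : ℕ} (H G : SimpleGraph (Fin n)) :
    subCount H G = (Finset.univ.filter
      (fun K : SimpleGraph (Fin n) => K ≤ G ∧ Nonempty (K ≃g H))).card := by
  rw [← Fintype.card_subtype, ← Nat.card_eq_fintype_card]
  have hsp : ∀ A : {A : G.Subgraph // Nonempty (H ≃g A.coe)}, A.1.IsSpanning := by
    intro A
    rw [← spanning_of_ncard, ← Nat.card_coe_set_eq, ← Nat.card_congr A.2.some.toEquiv,
      Nat.card_fin]
  apply Nat.card_congr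
  refine ⟨fun A => ⟨A.1.spanningCoe, A.1.spanningCoe_le,
      ⟨(Subgraph.spanningCoeEquivCoeOfSpanning A.1 (hsp A)).trans A.2.some.symm⟩⟩,
    fun K => ⟨toSubgraph K.1 K.2.1, ?_⟩, ?_, ?_⟩
  · have e := Subgraph.spanningCoeEquivCoeOfSpanning (toSubgraph K.1 K.2.1)
      (toSubgraph.isSpanning _ _)
    exact ⟨K.2.2.some.symm.trans e⟩
  · intro A
    exact Subtype.ext (toSubgraph_spanningCoe _ (hsp A))
  · intro K
    exact Subtype.ext rfl

open Classical in
theorem trans_sum {n : ℕ} (L : GSeq) (C : Set (SimpleGraph (Fin n)))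
    (hiso : ∀ G ∈ C, ∀ H, Nonempty (G ≃g H) → H ∈ C)
    (R : Finset (SimpleGraph (Fin n))) (hR : IsIsoTransversal C R)
    (G : SimpleGraph (Fin n)) :
    ∑ K : SimpleGraph (Fin n) with K ≤ G ∧ K ∈ C, coverCount L K =
      ∑ H ∈ R, coverCount L H * subCount H G := by
  have h1 : ∀ H ∈ R, coverCount L H * subCount H G =
      ∑ K : SimpleGraph (Fin n) with K ≤ G ∧ Nonempty (K ≃g H), coverCount L K := by
    intro H _
    rw [sub_eq, mul_comm, ← smul_eq_mul, ← Finset.sum_const]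
    apply Finset.sum_congr rfl
    intro K hK
    simp only [Finset.mem_filter] at hK
    exact (cover_iso L _ _ hK.2.2.some).symm
  rw [Finset.sum_congr rfl h1, ← Finset.sum_biUnion]
  · apply Finset.sum_congr _ (fun _ _ => rfl)
    ext K
    simp only [Finset.mem_filter, Finset.mem_univ, true_and, Finset.mem_biUnion]
    constructor
    · rintro ⟨hK, hC⟩
      obtain ⟨H, ⟨hH, e⟩, -⟩ := hR.2 K hC
      exact ⟨H, hH, hK, e⟩
    · rintro ⟨H, hH, hK, ⟨e⟩⟩
      exact ⟨hK, hiso H (hR.1 hH) K ⟨e.symm⟩⟩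
  · intro A hA B hB hAB
    rw [Function.onFun, Finset.disjoint_left]
    intro K h1 h2
    simp only [Finset.mem_filter, Finset.mem_univ, true_and] at h1 h2
    have hK : K ∈ C := hiso A (hR.1 hA) K ⟨h1.2.some.symm⟩
    exact hAB ((hR.2 K hK).unique ⟨hA, h1.2⟩ ⟨hB, h2.2⟩)

open Classical in
theorem exists_transversal {n : ℕ} (C : Set (SimpleGraph (Fin n)))
    (hiso : ∀ G ∈ C, ∀ H, Nonempty (G ≃g H) → H ∈ C) :
    ∃ R, IsIsoTransversal C R := by
  let S : Setoid (SimpleGraph (Fin n)) :=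
    ⟨fun A B => Nonempty (A ≃g B), fun A => ⟨Iso.refl⟩, fun ⟨e⟩ => ⟨e.symm⟩,
      fun ⟨e⟩ ⟨f⟩ => ⟨e.trans f⟩⟩
  have hout : ∀ A : SimpleGraph (Fin n), Nonempty ((Quotient.mk S A).out ≃g A) :=
    fun A => Quotient.mk_out (s := S) A
  refine ⟨Finset.univ.filter (fun A => A ∈ C ∧ (Quotient.mk S A).out = A), ?_, ?_⟩
  · intro A hA
    simp at hA
    exact hA.1
  · intro G hG
    refine ⟨(Quotient.mk S G).out, ⟨?_, ⟨(hout G).some.symm⟩⟩, ?_⟩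
    · simp only [Finset.mem_filter, Finset.mem_univ, true_and, Quotient.out_eq, and_true]
      exact hiso G hG _ ⟨(hout G).some.symm⟩
    · rintro B ⟨hB, e⟩
      simp only [Finset.mem_filter, Finset.mem_univ, true_and] at hB
      rw [← hB.2]
      congr 1
      exact (Quotient.sound (s := S) e).symm

end Helpers

/-- If `C` is a class of `n`-vertex graphs closed under isomorphism such that
`s(H,G)` is reconstructible for every `G ∈ C` and every `n`-vertex graph
`H ∉ C`, then `C` satisfies Kocay's lemma: for every sequence `L` of graphs with
fewer than `n` vertices, all `G, G' ∈ C` with `G'` a reconstruction of `G`, and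
any transversal `R` of the isomorphism classes of graphs in `C`,
`Σ_{H ∈ C/≅} c(L,H)·s(H,G') = Σ_{H ∈ C/≅} c(L,H)·s(H,G)`. -/
theorem stmt_4 {n : ℕ} (hn : 1 ≤ n) (C : Set (SimpleGraph (Fin n)))
    (hiso : ∀ G ∈ C, ∀ H, Nonempty (G ≃g H) → H ∈ C)
    (hs : ∀ G ∈ C, ∀ H : SimpleGraph (Fin n), H ∉ C →
      ∀ G', IsReconstruction G G' → subCount H G' = subCount H G)
    (L : GSeq) (hL : ∀ F ∈ L, F.1 < n)
    (G : SimpleGraph (Fin n)) (hG : G ∈ C)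
    (G' : SimpleGraph (Fin n)) (hG' : G' ∈ C)
    (hrec : IsReconstruction G G')
    (R : Finset (SimpleGraph (Fin n))) (hR : IsIsoTransversal C R) :
    ∑ H ∈ R, coverCount L H * subCount H G' =
      ∑ H ∈ R, coverCount L H * subCount H G := by
  classical
  have hisoc : ∀ G ∈ Cᶜ, ∀ H, Nonempty (G ≃g H) → H ∈ Cᶜ := by
    rintro A hA B ⟨e⟩ hB
    exact hA (hiso B hB A ⟨e.symm⟩)
  obtain ⟨R', hR'⟩ := exists_transversal Cᶜ hisoc
  have h := span_recon L hL G G' hrec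
  have split : ∀ G : SimpleGraph (Fin n),
      (Tup L.get G (fun H => H.verts.ncard = n)).ncard =
      ∑ H ∈ R, coverCount L H * subCount H G + ∑ H ∈ R', coverCount L H * subCount H G := by
    intro G
    rw [← trans_sum L C hiso R hR G, ← trans_sum L Cᶜ hisoc R' hR' G, span_eq,
      ← Finset.sum_filter_add_sum_filter_not _ (· ∈ C), Finset.filter_filter,
      Finset.filter_filter]
    congr!
  have h2 : ∑ H ∈ R', coverCount L H * subCount H G' =
      ∑ H ∈ R', coverCount L H * subCount H G :=
    Finset.sum_congr rfl (fun H hH => by rw [hs G hG H (hR'.1 hH) G' hrec])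
  rw [split, split, h2] at h
  · exact Nat.add_right_cancel h
end

section
/- Let n ≥ 3 and let C be a class of n-vertex simple graphs that is closed under isomorphism, recognisable, and satisfies Kocay's lemma (for all finite sequences of graphs with fewer than n vertices). Then there exists a finite family 𝔉 of finite sequences of simple graphs, each graph in each sequence having at most n − 1 vertices, such that the real matrix M with rows indexed by the sequences in 𝔉 and columns indexed by the isomorphism classes of graphs in C, whose (𝓕, [H]) entry is c(𝓕, H), satisfies rank_ℝ(M) = |C/∼|, the number of equivalence classes of C under the reconstruction relation ∼. -/
open SimpleGraph

lemma tri_zero {Q : Type*} [Fintype Q] (t : Q → Q → ℝ) (w : Q → ℤ) (h1 : ∀ q, t q q ≠ 0)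
    (h2 : ∀ q k, t q k ≠ 0 → q ≠ k → w q < w k) (x : Q → ℝ)
    (hx : ∀ q, ∑ k, t q k * x k = 0) : x = 0 := by
  classical
  by_contra hne
  obtain ⟨q0, hq0⟩ := Function.ne_iff.1 hne
  obtain ⟨q, hq, hmax⟩ := Finset.exists_max_image (Finset.univ.filter fun q => x q ≠ 0) w
    ⟨q0, by simpa using hq0⟩
  have := hx q
  rw [Finset.sum_eq_single q] at this
  · rcases mul_eq_zero.1 this with h | h
    · exact h1 q h
    · simp at hq; exact hq h
  · intro k _ hk
    by_contra hc
    have hk' := hmax k (by simpa using right_ne_zero_of_mul hc)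
    have := h2 q k (left_ne_zero_of_mul hc) (Ne.symm hk)
    omega
  · simp

lemma indicator_adjoin {X : Type*} [Finite X] (S : Set (X → ℝ)) (x0 : X) :
    ∃ p ∈ Algebra.adjoin ℝ S, ∀ y, ((∀ s ∈ S, s y = s x0) → p y = 1) ∧
      (¬ (∀ s ∈ S, s y = s x0) → p y = 0) := by
  classical
  cases nonempty_fintype X
  have key : ∀ x : X, ∃ h ∈ Algebra.adjoin ℝ S, (∀ y, (∀ s ∈ S, s y = s x0) → h y = 1) ∧
      (¬ (∀ s ∈ S, s x = s x0) → h x = 0) := by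
    intro x
    by_cases hx : ∀ s ∈ S, s x = s x0
    · exact ⟨1, one_mem _, fun _ _ => rfl, fun h => absurd hx h⟩
    · push Not at hx
      obtain ⟨s, hs, hne⟩ := hx
      refine ⟨(s x0 - s x)⁻¹ • (s - algebraMap ℝ (X → ℝ) (s x)), ?_, ?_, ?_⟩
      · exact Subalgebra.smul_mem _ (Subalgebra.sub_mem _ (Algebra.subset_adjoin hs)
          (Subalgebra.algebraMap_mem _ _)) _
      · intro y hy
        have : s x0 - s x ≠ 0 := sub_ne_zero.2 (Ne.symm hne)
        simp [hy s hs, this]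
      · intro _
        simp
  choose h hmem h1 h0 using key
  refine ⟨∏ x, h x, Subalgebra.prod_mem _ fun x _ => hmem x, fun y => ⟨fun hy => ?_, fun hy => ?_⟩⟩
  · rw [Finset.prod_apply]
    exact Finset.prod_eq_one fun x _ => h1 x y hy
  · rw [Finset.prod_apply]
    exact Finset.prod_eq_zero (Finset.mem_univ y) (h0 y hy)

noncomputable def sg {n : ℕ} (F : Σ k : ℕ, SimpleGraph (Fin k)) {H : SimpleGraph (Fin n)}
    (J : H.Subgraph) : ℕ :=
  Nat.card {C : H.Subgraph // C ≤ J ∧ Nonempty (F.2 ≃g C.coe)}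

noncomputable def gc {n : ℕ} (L : GSeq) {H : SimpleGraph (Fin n)} (J : H.Subgraph) : ℕ :=
  Nat.card {C : Fin L.length → H.Subgraph //
    (∀ i, Nonempty ((L.get i).2 ≃g (C i).coe)) ∧ (⨆ i, C i) = J}

lemma sg_top {n : ℕ} (F : Σ k : ℕ, SimpleGraph (Fin k)) (H : SimpleGraph (Fin n)) :
    sg F (⊤ : H.Subgraph) = subCount F.2 H := by
  simp [sg, subCount]

lemma prod_sg {n : ℕ} (L : GSeq) {H : SimpleGraph (Fin n)} (J : H.Subgraph) :
    (L.map fun F => sg F J).prod = ∑ᶠ J' : {J' : H.Subgraph // J' ≤ J}, gc L J'.1 := by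
  classical
  have e : (∀ i : Fin L.length, {C : H.Subgraph // C ≤ J ∧ Nonempty ((L.get i).2 ≃g C.coe)}) ≃
      Σ J' : {J' : H.Subgraph // J' ≤ J}, {C : Fin L.length → H.Subgraph //
    (∀ i, Nonempty ((L.get i).2 ≃g (C i).coe)) ∧ (⨆ i, C i) = J'.1} :=
    { toFun := fun c => ⟨⟨⨆ i, (c i).1, iSup_le fun i => (c i).2.1⟩,
        ⟨fun i => (c i).1, fun i => (c i).2.2, rfl⟩⟩
      invFun := fun d i => ⟨d.2.1 i, (le_iSup _ i).trans (d.2.2.2.le.trans d.1.2), d.2.2.1 i⟩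
      left_inv := fun c => rfl
      right_inv := by
        rintro ⟨⟨J', hJ'⟩, ⟨c, hc, hs⟩⟩
        dsimp only at hs
        subst hs
        rfl }
  have h := Nat.card_congr e
  cases nonempty_fintype {J' : H.Subgraph // J' ≤ J}
  rw [Nat.card_pi, Nat.card_sigma] at h
  rw [finsum_eq_sum_of_fintype]
  simp only [gc]
  rw [← h, ← Fin.prod_univ_fun_getElem]
  rfl

lemma sg_le {n : ℕ} (F : Σ k : ℕ, SimpleGraph (Fin k)) {H : SimpleGraph (Fin n)}
    (J : H.Subgraph) : sg F J ≤ subCount F.2 H := by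
  unfold sg subCount
  exact Nat.card_le_card_of_injective (fun C => (⟨C.1, C.2.2⟩ : {C : H.Subgraph // Nonempty (F.2 ≃g C.coe)}))
    (fun a b h => Subtype.ext (congrArg (fun z => z.1) h))

lemma sg_eq {n : ℕ} (F : Σ k : ℕ, SimpleGraph (Fin k)) {H : SimpleGraph (Fin n)}
    (J : H.Subgraph) (h : sg F J = subCount F.2 H) (C : H.Subgraph) (hC : Nonempty (F.2 ≃g C.coe)) :
    C ≤ J := by
  have hinj : Function.Injective
    (fun C : {C : H.Subgraph // C ≤ J ∧ Nonempty (F.2 ≃g C.coe)} =>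
      (⟨C.1, C.2.2⟩ : {C : H.Subgraph // Nonempty (F.2 ≃g C.coe)})) :=
    fun a b h => Subtype.ext (congrArg (fun z => z.1) h)
  have hb := (Nat.bijective_iff_injective_and_card _).2 ⟨hinj, h⟩
  obtain ⟨D, hD⟩ := hb.2 ⟨C, hC⟩
  have : D.1 = C := congrArg (fun z => z.1) hD
  exact this ▸ D.2.1

abbrev kone : Σ k : ℕ, SimpleGraph (Fin k) := ⟨1, ⊥⟩
abbrev ktwo : Σ k : ℕ, SimpleGraph (Fin k) := ⟨2, ⊤⟩

lemma eq_top_of_sg {n : ℕ} {H : SimpleGraph (Fin n)} (J : H.Subgraph)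
    (h : subCount kone.2 H + subCount ktwo.2 H ≤ sg kone J + sg ktwo J) : J = ⊤ := by
  have a1 := sg_le kone J
  have a2 := sg_le ktwo J
  have b1 := sg_eq kone J (by omega)
  have b2 := sg_eq ktwo J (by omega)
  have hv : ∀ v, v ∈ J.verts := fun v => by
    have := b1 (H.singletonSubgraph v)
      ⟨⟨Equiv.ofUnique _ _, by simp⟩⟩
    exact (SimpleGraph.singletonSubgraph_le_iff v J).1 this
  have he : ∀ u v, H.Adj u v → J.Adj u v := fun u v huv => by
    have : H.subgraphOfAdj huv ≤ J := by
      apply b2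
      let f : SimpleGraph.Copy (⊤ : SimpleGraph (Fin 2)) H :=
        ⟨⟨![u, v], by
          intro a b hab
          fin_cases a <;> fin_cases b <;> simp_all [huv.symm]⟩, by
          intro a b hab
          have := huv.ne
          have := huv.ne'
          fin_cases a <;> fin_cases b <;> simp_all⟩
      have hf : f.toSubgraph = H.subgraphOfAdj huv := by
        ext a b
        · simp [SimpleGraph.Copy.toSubgraph, f, eq_comm]
          tauto
        · simp [SimpleGraph.Copy.toSubgraph, f, Relation.Map, eq_comm]
          tauto
      rw [← hf]
      exact ⟨f.isoToSubgraph⟩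
    exact (SimpleGraph.subgraphOfAdj_le_iff huv J).1 this
  ext u v
  · simp [hv]
  · simpa using ⟨fun h => J.adj_sub h, he u v⟩

noncomputable def adjc {m : ℕ} (K : SimpleGraph (Fin m)) : ℕ :=
  Nat.card {p : Fin m × Fin m // K.Adj p.1 p.2}

lemma subCount_self_ne {m : ℕ} (K : SimpleGraph (Fin m)) : subCount K K ≠ 0 := by
  unfold subCount
  have : Nonempty {H : K.Subgraph // Nonempty (K ≃g H.coe)} :=
    ⟨⟨⊤, ⟨SimpleGraph.Subgraph.topIso.symm⟩⟩⟩
  exact Nat.card_pos.ne'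

lemma iso_of_subCount {m : ℕ} (F K : SimpleGraph (Fin m)) (h : subCount F K ≠ 0)
    (hle : adjc K ≤ adjc F) : Nonempty (F ≃g K) := by
  unfold subCount at h
  obtain ⟨⟨⟨C, ⟨e⟩⟩⟩, -⟩ := Nat.card_ne_zero.1 h
  let f : F →g K := C.hom.comp e.toHom
  have hf : Function.Injective f := SimpleGraph.Subgraph.hom_injective.comp e.injective
  have hfb : Function.Bijective f := Finite.injective_iff_bijective.1 hf
  let φ : {p : Fin m × Fin m // F.Adj p.1 p.2} → {p : Fin m × Fin m // K.Adj p.1 p.2} :=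
    fun p => ⟨(f p.1.1, f p.1.2), f.map_adj p.2⟩
  have hφ : Function.Injective φ := by
    rintro ⟨⟨a, b⟩, h1⟩ ⟨⟨c, d⟩, h2⟩ h
    simp only [φ, Subtype.mk.injEq, Prod.mk.injEq] at h
    simp [hf h.1, hf h.2]
  have hφb := (Nat.bijective_iff_injective_and_card φ).2
    ⟨hφ, le_antisymm (Nat.card_le_card_of_injective φ hφ) hle⟩
  refine ⟨⟨Equiv.ofBijective f hfb, ?_⟩⟩
  intro a b
  constructor
  · intro hab
    obtain ⟨⟨⟨c, d⟩, hcd⟩, hp⟩ := hφb.2 ⟨(f a, f b), hab⟩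
    have hp' : (f c, f d) = (f a, f b) := congrArg (fun z => z.1) hp
    rw [Prod.mk.injEq] at hp'
    rw [← hf hp'.1, ← hf hp'.2]
    exact hcd
  · intro hab
    exact f.map_adj hab

lemma card_avoid {k m : ℕ} {V : Type*} (F : SimpleGraph (Fin k)) (K : SimpleGraph (Fin m))
    (G : SimpleGraph V) (v : V) (e : K ≃g G.induce ({v}ᶜ : Set V)) :
    Nat.card {C : G.Subgraph // v ∉ C.verts ∧ Nonempty (F ≃g C.coe)} = subCount F K := by
  let φ : K ↪g G := (SimpleGraph.Embedding.induce ({v}ᶜ : Set V)).comp e.toEmbedding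
  have hφ : ∀ x, φ x ≠ v := fun x => (e x).2
  have hφ' : ∀ y, y ≠ v → ∃ x, φ x = y := fun y hy => ⟨e.symm ⟨y, hy⟩, by simp [φ]⟩
  have hφa : ∀ x y, K.Adj x y ↔ G.Adj (φ x) (φ y) := fun x y => φ.map_adj_iff.symm
  have hinj : Function.Injective φ := φ.injective
  symm
  unfold subCount
  refine Nat.card_eq_of_bijective
    (fun C : {H : K.Subgraph // Nonempty (F ≃g H.coe)} =>
    (⟨C.1.map φ.toHom, by
      rintro ⟨x, -, hx⟩
      exact hφ x hx, C.2.map fun i => (φ.toCopy.isoSubgraphMap C.1).comp i⟩ :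
      {C : G.Subgraph // v ∉ C.verts ∧ Nonempty (F ≃g C.coe)})) ⟨?_, ?_⟩
  · rintro ⟨C, hC⟩ ⟨D, hD⟩ h
    have h' : C.map φ.toHom = D.map φ.toHom := congrArg (fun z => z.1) h
    apply Subtype.ext
    have hv : φ '' C.verts = φ '' D.verts := congrArg (fun z => z.verts) h'
    ext a b
    · change a ∈ C.verts ↔ a ∈ D.verts
      rw [Set.image_injective.2 hinj hv]
    · have := congrArg (fun z => z.Adj (φ a) (φ b)) h'
      simpa [Relation.Map, hinj.eq_iff] using this
  · rintro ⟨D, hD, ⟨i⟩⟩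
    have hmap : (D.comap φ.toHom).map φ.toHom = D := by
      ext a b
      · constructor
        · rintro ⟨x, hx, rfl⟩
          exact hx
        · intro ha
          obtain ⟨x, rfl⟩ := hφ' a (fun h => hD (h ▸ ha))
          exact ⟨x, ha, rfl⟩
      · constructor
        · rintro ⟨x, y, hxy, rfl, rfl⟩
          exact hxy.2
        · intro hab
          obtain ⟨x, rfl⟩ := hφ' a (fun h => hD (h ▸ hab.fst_mem))
          obtain ⟨y, rfl⟩ := hφ' b (fun h => hD (h ▸ hab.snd_mem))
          exact ⟨x, y, ⟨(hφa x y).2 hab.adj_sub, hab⟩, rfl, rfl⟩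
    refine ⟨⟨D.comap φ.toHom, ?_⟩, Subtype.ext hmap⟩
    have j := (φ.toCopy.isoSubgraphMap (D.comap φ.toHom)).symm
    have j2 : F ≃g ((D.comap φ.toHom).map φ.toHom).coe := by rw [hmap]; exact i
    exact ⟨j.comp j2⟩

lemma subCount_succ {m : ℕ} (F : SimpleGraph (Fin m)) (G : SimpleGraph (Fin (m+1)))
    (K : Fin (m+1) → SimpleGraph (Fin m)) (e : ∀ v, Nonempty (K v ≃g vdel G v)) :
    subCount F G = ∑ v, subCount F (K v) := by
  have h1 : ∀ v, subCount F (K v) =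
      Nat.card {C : G.Subgraph // v ∉ C.verts ∧ Nonempty (F ≃g C.coe)} := fun v =>
    (card_avoid F (K v) G v (e v).some).symm
  simp_rw [h1]
  rw [← Nat.card_sigma]
  unfold subCount
  symm
  refine Nat.card_eq_of_bijective (fun s => ⟨s.2.1, s.2.2.2⟩) ⟨?_, ?_⟩
  all_goals
    have hone : ∀ C : G.Subgraph, Nonempty (F ≃g C.coe) → ∃ v, C.vertsᶜ = {v} := by
      rintro C ⟨i⟩
      rw [← Set.ncard_eq_one]
      have a := Set.ncard_add_ncard_compl C.verts
      have b : C.verts.ncard = m := by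
        rw [← Nat.card_coe_set_eq, ← Nat.card_congr i.toEquiv]; simp
      simp at a
      omega
  · rintro ⟨v, C, hv, hC⟩ ⟨w, D, hw, hD⟩ h
    have h' : C = D := congrArg (fun z => z.1) h
    subst h'
    obtain ⟨u, hu⟩ := hone C hC
    have h1 : v ∈ C.vertsᶜ := hv
    have h2 : w ∈ C.vertsᶜ := hw
    rw [hu] at h1 h2
    have : v = w := by rw [Set.mem_singleton_iff.1 h1, Set.mem_singleton_iff.1 h2]
    subst this
    rfl
  · rintro ⟨C, hC⟩
    obtain ⟨u, hu⟩ := hone C hC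
    have : u ∈ C.vertsᶜ := by rw [hu]; rfl
    exact ⟨⟨u, C, this, hC⟩, rfl⟩

def isoSetoid (m : ℕ) : Setoid (SimpleGraph (Fin m)) where
  r F K := Nonempty (F ≃g K)
  iseqv := ⟨fun _ => ⟨SimpleGraph.Iso.refl⟩, fun ⟨e⟩ => ⟨e.symm⟩, fun ⟨e⟩ ⟨f⟩ => ⟨f.comp e⟩⟩

lemma exists_class {m : ℕ} (G : SimpleGraph (Fin (m+1))) (v : Fin (m+1)) :
    ∃ q : Quotient (isoSetoid m), Nonempty (q.out ≃g vdel G v) := by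
  have e : ({v}ᶜ : Set (Fin (m+1))) ≃ Fin m := by
    apply Fintype.equivOfCardEq
    rw [← Nat.card_eq_fintype_card, Nat.card_coe_set_eq, Set.ncard_compl]
    simp
  let K : SimpleGraph (Fin m) := (vdel G v).map e.toEmbedding
  refine ⟨Quotient.mk (isoSetoid m) K, ?_⟩
  obtain ⟨i⟩ : Nonempty ((Quotient.mk (isoSetoid m) K).out ≃g K) :=
    Quotient.exact (s := isoSetoid m) (Quotient.out_eq _)
  exact ⟨(SimpleGraph.Iso.map e (vdel G v)).symm.comp i⟩

lemma recon_of_subCount {m : ℕ} (G G' : SimpleGraph (Fin (m+1)))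
    (h : ∀ F : SimpleGraph (Fin m), subCount F G = subCount F G') : IsReconstruction G G' := by
  classical
  choose a ha using exists_class G
  choose b hb using exists_class G'
  cases nonempty_fintype (Quotient (isoSetoid m))
  let t : Quotient (isoSetoid m) → Quotient (isoSetoid m) → ℝ := fun q k => subCount q.out k.out
  let cnt : (Fin (m+1) → Quotient (isoSetoid m)) → Quotient (isoSetoid m) → ℝ :=
    fun a q => ∑ v, if a v = q then 1 else 0
  have hcnt : ∀ a q, cnt a q = (Fintype.card {v // a v = q} : ℝ) := by
    intro a q
    simp [cnt, Fintype.card_subtype]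
  have hsum : ∀ a q, ∑ k, t q k * cnt a k = ∑ v, t q (a v) := by
    intro a q
    simp only [cnt, Finset.mul_sum]
    rw [Finset.sum_comm]
    simp
  have hx : cnt a - cnt b = 0 := by
    apply tri_zero t (fun q => (adjc q.out : ℤ))
    · intro q
      simpa [t] using subCount_self_ne q.out
    · intro q k hqk hne
      by_contra hlt
      apply hne
      have := iso_of_subCount q.out k.out (by simpa [t] using hqk) (by simpa using hlt)
      rw [← Quotient.out_eq q, ← Quotient.out_eq k]
      exact Quotient.sound (s := isoSetoid m) this
    · intro q
      simp only [Pi.sub_apply, mul_sub, Finset.sum_sub_distrib]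
      rw [hsum, hsum, sub_eq_zero]
      have h1 := subCount_succ q.out G _ ha
      have h2 := subCount_succ q.out G' _ hb
      rw [h] at h1
      simp only [t]
      exact_mod_cast h1.symm.trans h2
  have hc : ∀ q, Fintype.card {v // a v = q} = Fintype.card {v // b v = q} := by
    intro q
    have := congrFun hx q
    simp only [Pi.sub_apply, hcnt, Pi.zero_apply, sub_eq_zero] at this
    exact_mod_cast this
  let f := Equiv.ofFiberEquiv (fun q => Fintype.equivOfCardEq (hc q))
  refine ⟨f, fun v => ?_⟩
  have hf : b (f v) = a v := Equiv.ofFiberEquiv_map _ v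
  have h2 := hb (f v)
  rw [hf] at h2
  exact ⟨h2.some.comp (ha v).some.symm⟩

lemma recon_of_iso {n : ℕ} (G H : SimpleGraph (Fin n)) (h : Nonempty (G ≃g H)) :
    IsReconstruction G H := by
  obtain ⟨e⟩ := h
  refine ⟨e.toEquiv, fun v => ⟨⟨e.toEquiv.subtypeEquiv ?_, ?_⟩⟩⟩
  · intro a; simp
  · intro a b; exact e.map_adj_iff

lemma recon_trans {n : ℕ} {G H K : SimpleGraph (Fin n)} (h : IsReconstruction G H)
    (h' : IsReconstruction H K) : IsReconstruction G K := by
  obtain ⟨f, hf⟩ := h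
  obtain ⟨g, hg⟩ := h'
  exact ⟨f.trans g, fun v => ⟨(hg (f v)).some.comp (hf v).some⟩⟩

abbrev Xt (n : ℕ) : Type := Σ H : SimpleGraph (Fin n), H.Subgraph

def good (n : ℕ) (L : GSeq) : Prop := ∀ F ∈ L, F.1 < n

noncomputable def Pv {n : ℕ} (L : GSeq) : Xt n → ℝ := fun x => (L.map fun F => (sg F x.2 : ℝ)).prod

noncomputable def wv {n : ℕ} (R : Finset (SimpleGraph (Fin n))) (L : GSeq) : R → ℝ :=
  fun H => (coverCount L H.1 : ℝ)

lemma span_lift {n : ℕ} (R : Finset (SimpleGraph (Fin n))) (p : Xt n → ℝ)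
    (hp : p ∈ Submodule.span ℝ (Pv '' {L | good n L})) :
    ∃ u : Xt n → ℝ, (fun H : R => u ⟨H.1, ⊤⟩) ∈ Submodule.span ℝ (wv R '' {L | good n L}) ∧
      ∀ (H : SimpleGraph (Fin n)) (J : H.Subgraph),
        p ⟨H, J⟩ = ∑ᶠ J' : {J' : H.Subgraph // J' ≤ J}, u ⟨H, J'.1⟩ := by
  induction hp using Submodule.span_induction with
  | mem x hx =>
    obtain ⟨L, hL, rfl⟩ := hx
    refine ⟨fun x => (gc L x.2 : ℝ), Submodule.subset_span ⟨L, hL, rfl⟩, fun H J => ?_⟩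
    have := prod_sg L J
    cases nonempty_fintype {J' : H.Subgraph // J' ≤ J}
    rw [finsum_eq_sum_of_fintype] at this ⊢
    simp only [Pv]
    have h2 := congrArg (fun z : ℕ => (z : ℝ)) this
    push_cast at h2
    rw [← h2, List.map_map]
    rfl
  | zero => exact ⟨0, Submodule.zero_mem _, fun H J => by simp⟩
  | add x y _ _ hx hy =>
    obtain ⟨u, hu, hu'⟩ := hx
    obtain ⟨v, hv, hv'⟩ := hy
    refine ⟨u + v, Submodule.add_mem _ hu hv, fun H J => ?_⟩
    cases nonempty_fintype {J' : H.Subgraph // J' ≤ J}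
    simp [hu', hv', finsum_eq_sum_of_fintype, Finset.sum_add_distrib]
  | smul c x _ hx =>
    obtain ⟨u, hu, hu'⟩ := hx
    refine ⟨c • u, Submodule.smul_mem _ c hu, fun H J => ?_⟩
    cases nonempty_fintype {J' : H.Subgraph // J' ≤ J}
    simp [hu', finsum_eq_sum_of_fintype, Finset.mul_sum]

lemma zeta_inv {P : Type*} [PartialOrder P] [OrderTop P] [Finite P] (p u : P → ℝ)
    (h : ∀ J, p J = ∑ᶠ J' : {J' : P // J' ≤ J}, u J'.1) (h0 : ∀ J, J ≠ ⊤ → p J = 0) :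
    u ⊤ = p ⊤ := by
  classical
  have key : ∀ J : P, (∀ J' < J, u J' = 0) → p J = u J := by
    intro J hJ
    rw [h, finsum_eq_single _ (⟨J, le_rfl⟩ : {J' : P // J' ≤ J})]
    rintro ⟨J', hJ'⟩ hne
    exact hJ J' (lt_of_le_of_ne hJ' fun e => hne (Subtype.ext e))
  have z : ∀ J : P, J ≠ ⊤ → u J = 0 := by
    intro J
    induction J using (Finite.to_wellFoundedLT (α := P)).wf.induction with
    | _ J ih =>
      intro hJ
      rw [← key J fun J' hJ' => ih J' hJ' (ne_top_of_lt hJ'), h0 J hJ]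
  exact (key ⊤ fun J' hJ' => z J' hJ'.ne).symm

lemma adjoin_le_span {n : ℕ} (p : Xt n → ℝ)
    (hp : p ∈ Algebra.adjoin ℝ ((fun (F : Σ k : ℕ, SimpleGraph (Fin k)) (x : Xt n) => (sg F x.2 : ℝ)) ''
      {F | F.1 < n})) : p ∈ Submodule.span ℝ (Pv '' {L | good n L}) := by
  rw [← Subalgebra.mem_toSubmodule, Algebra.adjoin_eq_span] at hp
  refine Submodule.span_mono ?_ hp
  intro f hf
  induction hf using Submonoid.closure_induction with
  | mem x hx =>
    obtain ⟨F, hF, rfl⟩ := hx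
    exact ⟨[F], by simpa [good] using hF, by ext x; simp [Pv]⟩
  | one => exact ⟨[], by simp [good], by ext x; simp [Pv]⟩
  | mul x y _ _ hx hy =>
    obtain ⟨L, hL, rfl⟩ := hx
    obtain ⟨L', hL', rfl⟩ := hy
    refine ⟨L ++ L', ?_, by ext x; simp [Pv]⟩
    intro F hF
    rcases List.mem_append.1 hF with h | h
    · exact hL F h
    · exact hL' F h

noncomputable def wt {n : ℕ} (H : SimpleGraph (Fin n)) : ℕ := subCount kone.2 H + subCount ktwo.2 H

lemma exists_vec {n : ℕ} (hn : 3 ≤ n) (R : Finset (SimpleGraph (Fin n)))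
    (H0 : SimpleGraph (Fin n)) :
    ∃ y ∈ Submodule.span ℝ (wv R '' {L | good n L}), ∀ H : R, wt H.1 ≤ wt H0 →
      ((∀ F : Σ k : ℕ, SimpleGraph (Fin k), F.1 < n → subCount F.2 H.1 = subCount F.2 H0) → y H = 1) ∧
      (¬ (∀ F : Σ k : ℕ, SimpleGraph (Fin k), F.1 < n → subCount F.2 H.1 = subCount F.2 H0) →
        y H = 0) := by
  obtain ⟨p, hp, hp'⟩ := indicator_adjoin
    ((fun (F : Σ k : ℕ, SimpleGraph (Fin k)) (x : Xt n) => (sg F x.2 : ℝ)) '' {F | F.1 < n})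
    (⟨H0, ⊤⟩ : Xt n)
  obtain ⟨u, hu, hu'⟩ := span_lift R p (adjoin_le_span p hp)
  refine ⟨_, hu, fun H hH => ?_⟩
  have hz : u ⟨H.1, ⊤⟩ = p ⟨H.1, ⊤⟩ := by
    apply zeta_inv (fun J => p ⟨H.1, J⟩) (fun J => u ⟨H.1, J⟩) (hu' H.1)
    intro J hJ
    apply (hp' ⟨H.1, J⟩).2
    intro hall
    apply hJ
    apply eq_top_of_sg
    have e1 := hall _ ⟨kone, by show 1 < n; omega, rfl⟩
    have e2 := hall _ ⟨ktwo, by show 2 < n; omega, rfl⟩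
    simp only [sg_top, Nat.cast_inj] at e1 e2
    rw [e1, e2]
    exact hH
  rw [hz]
  have := hp' ⟨H.1, ⊤⟩
  simpa only [Set.forall_mem_image, Set.mem_setOf_eq, sg_top, Nat.cast_inj] using this

/-- Let `n ≥ 3` and let `C` be a class of `n`-vertex graphs closed under
isomorphism, recognisable, and satisfying Kocay's lemma (for all sequences of
graphs with fewer than `n` vertices). Then there is a finite family
`𝔉 = (L_1, …, L_l)` of sequences of graphs, each graph having at most `n − 1`
vertices, such that the matrix of covering numbers `c(L_i, H)` — rows indexed by
`Fin l`, columns indexed by the isomorphism classes of graphs in `C` (a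
transversal `R`) — has rank `|C/∼| = D.card` over `ℝ`, for `D` any transversal
of the reconstruction classes of `C`. -/
theorem stmt_10 {n : ℕ} (hn : 3 ≤ n) (C : Set (SimpleGraph (Fin n)))
    (hiso : ∀ G ∈ C, ∀ H, Nonempty (G ≃g H) → H ∈ C)
    (hrecog : ∀ G ∈ C, ∀ H, IsReconstruction G H → H ∈ C)
    (R : Finset (SimpleGraph (Fin n))) (hR : IsIsoTransversal C R)
    (hKocay : ∀ L : GSeq, (∀ F ∈ L, F.1 < n) →
      ∀ G ∈ C, ∀ G' ∈ C, IsReconstruction G G' →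
        ∑ H ∈ R, coverCount L H * subCount H G' =
          ∑ H ∈ R, coverCount L H * subCount H G)
    (D : Finset (SimpleGraph (Fin n))) (hD : IsReconTransversal C D) :
    ∃ (l : ℕ) (𝔉 : Fin l → GSeq),
      (∀ i : Fin l, ∀ F ∈ 𝔉 i, F.1 ≤ n - 1) ∧
      (Matrix.of fun (i : Fin l) (H : ↥R) =>
          ((coverCount (𝔉 i) (H : SimpleGraph (Fin n)) : ℝ))).rank = D.card := by
  classical
  set good' := {L | good n L} with hgood
  -- upper bound
  have upper : ∀ (l : ℕ) (𝔉 : Fin l → GSeq), (∀ i, good n (𝔉 i)) →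
      (Matrix.of fun (i : Fin l) (H : ↥R) =>
          ((coverCount (𝔉 i) (H : SimpleGraph (Fin n)) : ℝ))).rank ≤ D.card := by
    intro l 𝔉 h𝔉
    set M := (Matrix.of fun (i : Fin l) (H : ↥R) =>
          ((coverCount (𝔉 i) (H : SimpleGraph (Fin n)) : ℝ))) with hM
    let S : Matrix R R ℝ := Matrix.of fun H G => (subCount H.1 G.1 : ℝ)
    have hS : IsUnit S := by
      rw [← Matrix.mulVec_injective_iff_isUnit]
      intro x y hxy
      rw [← sub_eq_zero]
      apply tri_zero (fun H G => S H G) (fun H => (adjc H.1 : ℤ))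
      · intro q
        simpa [S] using subCount_self_ne q.1
      · intro q k hqk hne
        by_contra hlt
        apply hne
        have hi := iso_of_subCount q.1 k.1 (by simpa [S] using hqk) (by simpa using hlt)
        have hu := (hR.2 q.1 (hR.1 q.2)).unique ⟨q.2, ⟨SimpleGraph.Iso.refl⟩⟩ ⟨k.2, hi⟩
        exact Subtype.ext hu
      · intro q
        have := congrFun hxy q
        simp only [Matrix.mulVec, dotProduct] at this
        simp only [Pi.sub_apply, mul_sub, Finset.sum_sub_distrib]
        linarith
    have hrk : (M * S).rank = M.rank :=
      Matrix.rank_mul_eq_left_of_isUnit_det S M ((Matrix.isUnit_iff_isUnit_det S).1 hS)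
    rw [← hrk]
    have hrep : ∀ G : R, ∃ d : D, IsReconstruction G.1 d.1 := fun G => by
      obtain ⟨d, ⟨hd, hd'⟩, -⟩ := hD.2 G.1 (hR.1 G.2)
      exact ⟨⟨d, hd⟩, hd'⟩
    choose rep hrep using hrep
    let B : Matrix (Fin l) D ℝ := Matrix.of fun i d =>
      ∑ H ∈ R, (coverCount (𝔉 i) H : ℝ) * (subCount H d.1 : ℝ)
    let Pm : Matrix D R ℝ := Matrix.of fun d G => if rep G = d then 1 else 0
    have hfac : M * S = B * Pm := by
      ext i G
      have hk := hKocay (𝔉 i) (h𝔉 i) G.1 (hR.1 G.2) (rep G).1 (hD.1 (rep G).2) (hrep G)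
      simp only [Matrix.mul_apply, M, S, B, Pm, Matrix.of_apply, mul_ite, mul_one, mul_zero,
        Finset.sum_ite_eq, Finset.mem_univ, if_true]
      have hk' := congrArg (fun z : ℕ => (z : ℝ)) hk
      push_cast at hk'
      rw [hk', ← Finset.sum_coe_sort R]
    rw [hfac]
    refine (Matrix.rank_mul_le_left B Pm).trans ?_
    simpa using Matrix.rank_le_card_width B
  -- lower bound
  have lower : D.card ≤ Module.finrank ℝ (Submodule.span ℝ (wv R '' good')) := by
    have hr : ∀ d : D, ∃ H : R, Nonempty (d.1 ≃g H.1) := fun d => by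
      obtain ⟨H, ⟨hH, hH'⟩, -⟩ := hR.2 d.1 (hD.1 d.2)
      exact ⟨⟨H, hH⟩, hH'⟩
    choose r hr using hr
    have hinj : ∀ d d' : D, (∀ F : Σ k : ℕ, SimpleGraph (Fin k), F.1 < n →
        subCount F.2 (r d).1 = subCount F.2 (r d').1) → d = d' := by
      intro d d' h
      have h1 : IsReconstruction (r d).1 (r d').1 := by
        obtain ⟨m, rfl⟩ : ∃ m, n = m + 1 := ⟨n - 1, by omega⟩
        exact recon_of_subCount _ _ fun F => h ⟨m, F⟩ (Nat.lt_succ_self m)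
      have h2 := recon_trans (recon_of_iso _ _ (hr d)) (recon_trans h1
        (recon_of_iso _ _ ((hr d').map fun e => e.symm)))
      exact Subtype.ext ((hD.2 d.1 (hD.1 d.2)).unique
        ⟨d.2, recon_of_iso _ _ ⟨SimpleGraph.Iso.refl⟩⟩ ⟨d'.2, h2⟩)
    choose y hy hy' using fun d : D => exists_vec hn R (r d).1
    have hli : LinearIndependent ℝ (fun d : D =>
        (⟨y d, hy d⟩ : Submodule.span ℝ (wv R '' good'))) := by
      rw [Fintype.linearIndependent_iff]
      intro g hg
      have hg' : ∀ H : R, ∑ d, g d * y d H = 0 := fun H => by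
        have h1 := congrArg (fun z => z.1) hg
        have h2 := congrFun h1 H
        simpa using h2
      have hz : g = 0 := by
        apply tri_zero (fun d' d => y d (r d')) (fun d => -(wt (r d).1 : ℤ))
        · intro q
          rw [(hy' q (r q) le_rfl).1 fun _ _ => rfl]
          exact one_ne_zero
        · intro q k hqk hne
          by_contra hlt
          apply hqk
          exact (hy' k (r q) (by omega)).2 fun hall => hne (hinj q k hall)
        · intro q
          rw [← hg' (r q)]
          exact Finset.sum_congr rfl fun _ _ => mul_comm _ _
      exact fun d => congrFun hz d
    simpa using hli.fintype_card_le_finrank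
  obtain ⟨f, hf, hspan, -⟩ := Submodule.exists_fun_fin_finrank_span_eq ℝ (wv R '' good')
  choose 𝔉 h𝔉 hf𝔉 using hf
  refine ⟨_, 𝔉, fun i F hF => by have := h𝔉 i F hF; omega, ?_⟩
  apply le_antisymm (upper _ 𝔉 h𝔉)
  rw [Matrix.rank_eq_finrank_span_row]
  have : (Set.range (Matrix.of fun (i : Fin _) (H : ↥R) =>
          ((coverCount (𝔉 i) (H : SimpleGraph (Fin n)) : ℝ))).row) = Set.range f := by
    congr 1
    ext i H
    rw [← hf𝔉 i]
    rfl
  rw [this, hspan]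
  exact lower
end

section
/- Let n ≥ 3. There exists a finite family 𝔉 of finite sequences of simple graphs, each graph in each sequence having at most n − 1 vertices, such that the real matrix M with rows indexed by the sequences in 𝔉 and columns indexed by the isomorphism classes of n-vertex simple graphs, whose (𝓕, [H]) entry is c(𝓕, H), satisfies rank_ℝ(M) = d(n), where d(n) is the number of equivalence classes of n-vertex simple graphs under the reconstruction relation ∼. -/
open SimpleGraph

section Aux
open scoped Classical

/-- subgraphs of the complete graph -/
abbrev XS (n : ℕ) := (⊤ : SimpleGraph (Fin n)).Subgraph

def toX {n : ℕ} (G : SimpleGraph (Fin n)) : XS n where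
  verts := Set.univ
  Adj := G.Adj
  adj_sub h := h.ne
  edge_vert _ := trivial
  symm := G.symm

theorem le_toX {n : ℕ} (u : XS n) (G : SimpleGraph (Fin n)) :
    u ≤ toX G ↔ ∀ a b, u.Adj a b → G.Adj a b :=
  ⟨fun h _ _ hab => h.2 hab, fun h => ⟨fun _ _ => trivial, h⟩⟩

theorem toX_inj {n : ℕ} {G H : SimpleGraph (Fin n)} (h : toX G = toX H) : G = H := by
  ext a b
  have := congrArg (fun u : XS n => u.Adj a b) h
  exact iff_of_eq this

def pm {n : ℕ} (σ : Equiv.Perm (Fin n)) (u : XS n) : XS n where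
  verts := σ ⁻¹' u.verts
  Adj a b := u.Adj (σ a) (σ b)
  adj_sub h := by
    have := u.adj_sub h
    simp only [top_adj, ne_eq, EmbeddingLike.apply_eq_iff_eq] at this ⊢
    exact this
  edge_vert h := u.edge_vert h
  symm := ⟨fun _ _ h => Subgraph.Adj.symm h⟩

def pmE {n : ℕ} (σ : Equiv.Perm (Fin n)) : XS n ≃ XS n where
  toFun := pm σ
  invFun := pm σ.symm
  left_inv u := by ext <;> simp [pm]
  right_inv u := by ext <;> simp [pm]

theorem pm_sup {n : ℕ} (σ : Equiv.Perm (Fin n)) (u v : XS n) :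
    pm σ (u ⊔ v) = pm σ u ⊔ pm σ v := by
  ext <;> simp [pm]

theorem pm_bot {n : ℕ} (σ : Equiv.Perm (Fin n)) : pm σ ⊥ = ⊥ := by
  ext <;> simp [pm]

def pmIso {n : ℕ} (σ : Equiv.Perm (Fin n)) (u : XS n) : (pm σ u).coe ≃g u.coe where
  toEquiv := σ.subtypeEquiv (fun a => Iff.rfl)
  map_rel_iff' := by exact Iff.rfl

abbrev IsoTo (F : Σ k : ℕ, SimpleGraph (Fin k)) {n : ℕ} (u : XS n) : Prop :=
  Nonempty (F.2 ≃g u.coe)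

theorem isoTo_pm {n : ℕ} (F : Σ k : ℕ, SimpleGraph (Fin k)) (σ : Equiv.Perm (Fin n)) (u : XS n) :
    IsoTo F (pm σ u) ↔ IsoTo F u :=
  ⟨fun ⟨e⟩ => ⟨e.trans (pmIso σ u)⟩, fun ⟨e⟩ => ⟨e.trans (pmIso σ u).symm⟩⟩

noncomputable def Sf {n : ℕ} : GSeq → ((XS n → ℝ) →ₗ[ℝ] ℝ)
  | [] => LinearMap.proj ⊥
  | F :: L => ∑ x : XS n, if IsoTo F x then
      (Sf L).comp (LinearMap.funLeft ℝ ℝ (fun y => x ⊔ y)) else 0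

theorem Sf_nil {n : ℕ} (φ : XS n → ℝ) : Sf [] φ = φ ⊥ := rfl

theorem Sf_cons {n : ℕ} (F) (L : GSeq) (φ : XS n → ℝ) :
    Sf (F :: L) φ = ∑ x : XS n, if IsoTo F x then Sf L (fun y => φ (x ⊔ y)) else 0 := by
  rw [Sf, LinearMap.sum_apply]
  refine Finset.sum_congr rfl fun x _ => ?_
  split_ifs <;> rfl

theorem Sf_pm {n : ℕ} (σ : Equiv.Perm (Fin n)) (L : GSeq) : ∀ φ : XS n → ℝ,
    Sf L (fun u => φ (pm σ u)) = Sf L φ := by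
  induction L with
  | nil => intro φ; simp [Sf_nil, pm_bot]
  | cons F L ih =>
    intro φ
    rw [Sf_cons, Sf_cons]
    refine Fintype.sum_equiv (pmE σ) _ _ fun x => ?_
    change _ = if IsoTo F (pm σ x) then Sf L (fun y => φ (pm σ x ⊔ y)) else 0
    rw [← ih (fun y => φ (pm σ x ⊔ y))]
    simp only [isoTo_pm, pm_sup]

noncomputable def dl {n : ℕ} (u : XS n) : XS n → ℝ := fun x => if x = u then 1 else 0

noncomputable def cc {n : ℕ} (L : GSeq) (u : XS n) : ℝ := Sf L (dl u)

theorem Sf_eq {n : ℕ} (L : GSeq) (φ : XS n → ℝ) : Sf L φ = ∑ u, φ u * cc L u := by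
  have : φ = ∑ u, φ u • dl u := by
    ext x; simp [dl]
  conv_lhs => rw [this]
  simp [cc]

theorem cc_pm {n : ℕ} (L : GSeq) (σ : Equiv.Perm (Fin n)) (u : XS n) :
    cc L (pm σ u) = cc L u := by
  rw [cc, cc, ← Sf_pm σ]
  congr 1; ext x
  simp only [dl]
  exact if_congr ((pmE σ).injective.eq_iff) rfl rfl

noncomputable def iLe {n : ℕ} (G : SimpleGraph (Fin n)) (u : XS n) : ℝ :=
  if u ≤ toX G then 1 else 0

theorem iLe_sup {n : ℕ} (G : SimpleGraph (Fin n)) (u v : XS n) :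
    iLe G (u ⊔ v) = iLe G u * iLe G v := by
  simp only [iLe, sup_le_iff]; split_ifs <;> simp_all

noncomputable def sN {n : ℕ} (F : Σ k : ℕ, SimpleGraph (Fin k)) (G : SimpleGraph (Fin n)) : ℝ :=
  ∑ u : XS n, if IsoTo F u then iLe G u else 0

noncomputable def NN {n : ℕ} (L : GSeq) (G : SimpleGraph (Fin n)) : ℝ := Sf L (iLe G)

theorem NN_nil {n : ℕ} (G : SimpleGraph (Fin n)) : NN [] G = 1 := by
  simp [NN, Sf_nil, iLe]

theorem NN_cons {n : ℕ} (F) (L : GSeq) (G : SimpleGraph (Fin n)) :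
    NN (F :: L) G = sN F G * NN L G := by
  rw [NN, Sf_cons, sN, Finset.sum_mul]
  refine Finset.sum_congr rfl fun x _ => ?_
  simp only [iLe_sup, NN]
  split_ifs
  · exact (Sf L).map_smul (iLe G x) (iLe G)
  · simp

noncomputable def Zt {n : ℕ} (t : ℕ) (L : GSeq) (G : SimpleGraph (Fin n)) : ℝ :=
  Sf L (fun u => if u.vertsᶜ.ncard = t then iLe G u else 0)

theorem NN_eq {n : ℕ} (L : GSeq) (G : SimpleGraph (Fin n)) :
    NN L G = ∑ t ∈ Finset.range (n+1), Zt t L G := by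
  simp only [Zt, NN]
  rw [← map_sum]
  congr 1; ext u
  rw [Finset.sum_apply, Finset.sum_ite_eq, if_pos]
  rw [Finset.mem_range]
  have := Set.ncard_le_card u.vertsᶜ
  simp at this
  omega

def K1 : Σ k : ℕ, SimpleGraph (Fin k) := ⟨1, ⊥⟩

theorem isoTo_K1 {n : ℕ} (u : XS n) : IsoTo K1 u ↔ ∃ v, u = (⊤ : SimpleGraph (Fin n)).singletonSubgraph v := by
  constructor
  · rintro ⟨e⟩
    have h1 : ∀ x : u.verts, x = e (0 : Fin 1) := by
      intro x
      have : e.symm x = (0 : Fin 1) := Subsingleton.elim (α := Fin 1) _ _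
      rw [← this]; simp
    refine ⟨(e (0 : Fin 1)).1, ?_⟩
    have hv : ∀ a, a ∈ u.verts ↔ a = (e (0 : Fin 1)).1 := by
      intro a
      refine ⟨fun h => congrArg Subtype.val (h1 ⟨a, h⟩), ?_⟩
      rintro rfl; exact (e (0 : Fin 1)).2
    ext a b
    · simpa using hv a
    · simp only [singletonSubgraph_adj, Pi.bot_apply, Prop.bot_eq_false, iff_false]
      intro h
      have h2 := (hv a).1 h.fst_mem
      have h3 := (hv b).1 h.snd_mem
      exact h.ne (h2.trans h3.symm)
  · rintro ⟨v, rfl⟩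
    have : Unique ((⊤ : SimpleGraph (Fin n)).singletonSubgraph v).verts :=
      ⟨⟨⟨v, rfl⟩⟩, fun x => Subtype.ext x.2⟩
    refine ⟨⟨Equiv.ofUnique (Fin 1) _, ?_⟩⟩
    intro a b
    have : ¬ K1.2.Adj a b := fun h => h
    simp [this]

theorem sum_K1 {n : ℕ} (g : XS n → ℝ) :
    (∑ x : XS n, if IsoTo K1 x then g x else 0) =
      ∑ v : Fin n, g ((⊤ : SimpleGraph (Fin n)).singletonSubgraph v) := by
  rw [← Finset.sum_filter]
  symm
  refine Finset.sum_bij (fun v _ => (⊤ : SimpleGraph (Fin n)).singletonSubgraph v) ?_ ?_ ?_ ?_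
  · intro v _; simp only [Finset.mem_filter, Finset.mem_univ, true_and]
    exact (isoTo_K1 _).2 ⟨v, rfl⟩
  · intro a _ b _ h
    have := congrArg Subgraph.verts h
    simpa using this
  · intro u hu
    simp only [Finset.mem_filter, Finset.mem_univ, true_and] at hu
    obtain ⟨v, rfl⟩ := (isoTo_K1 _).1 hu
    exact ⟨v, by simp, rfl⟩
  · simp

theorem Zt_K1 {n : ℕ} (t : ℕ) (L : GSeq) (G : SimpleGraph (Fin n)) :
    Zt t (K1 :: L) G = (t + 1) * Zt (t+1) L G + ((n : ℝ) - t) * Zt t L G := by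
  simp only [Zt]
  rw [Sf_cons, sum_K1 (fun x => Sf L (fun y => if (x ⊔ y).vertsᶜ.ncard = t then iLe G (x ⊔ y) else 0)),
    ← map_sum, ← smul_eq_mul, ← smul_eq_mul, ← map_smul, ← map_smul, ← map_add]
  congr 1
  ext u
  simp only [Finset.sum_apply, Pi.add_apply, Pi.smul_apply, smul_eq_mul]
  have h1 : ∀ v, iLe G ((⊤ : SimpleGraph (Fin n)).singletonSubgraph v ⊔ u) = iLe G u := by
    intro v
    rw [iLe_sup]
    have : iLe G ((⊤ : SimpleGraph (Fin n)).singletonSubgraph v) = 1 := by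
      rw [iLe, if_pos]; rw [le_toX]; simp
    rw [this, one_mul]
  have h2 : ∀ v, ((⊤ : SimpleGraph (Fin n)).singletonSubgraph v ⊔ u).vertsᶜ.ncard =
      if v ∈ u.verts then u.vertsᶜ.ncard else u.vertsᶜ.ncard - 1 := by
    intro v
    have : ((⊤ : SimpleGraph (Fin n)).singletonSubgraph v ⊔ u).vertsᶜ = u.vertsᶜ \ {v} := by
      ext a; simp; tauto
    rw [this]
    split_ifs with h
    · congr 1; ext a; simp; rintro ha rfl; exact ha h
    · exact Set.ncard_sdiff_singleton_of_mem h
  simp only [h1, h2]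
  set j := u.vertsᶜ.ncard with hj
  have h3 : ∀ v, (if (if v ∈ u.verts then j else j - 1) = t then iLe G u else 0) =
      (if v ∈ u.vertsᶜ then (if j - 1 = t then iLe G u else 0) else (if j = t then iLe G u else 0)) := by
    intro v
    by_cases h : v ∈ u.verts <;> simp [h]
  simp only [h3]
  rw [Finset.sum_ite, Finset.sum_const, Finset.sum_const]
  have h4 : (Finset.univ.filter (fun v => v ∈ u.vertsᶜ)).card = j := by
    rw [hj, Set.ncard_eq_toFinset_card']; congr 1; ext; simp
  have h5 : ((Finset.univ.filter (fun v => ¬ v ∈ u.vertsᶜ)).card : ℝ) = n - j := by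
    have := Finset.card_filter_add_card_filter_not (s := (Finset.univ : Finset (Fin n))) (fun v => v ∈ u.vertsᶜ)
    rw [h4] at this
    simp only [Finset.card_univ, Fintype.card_fin] at this
    rw [eq_sub_iff_add_eq, add_comm]; exact_mod_cast this
  rw [nsmul_eq_mul, nsmul_eq_mul, h4, h5]
  by_cases ha : j = t
  · subst ha
    rcases Nat.eq_zero_or_pos j with h0 | h0
    · simp [h0]
    · have : j - 1 ≠ j := by omega
      simp [this]
  · by_cases hb : j = t + 1
    · simp [hb]
    · have : j = 0 ∨ j - 1 ≠ t := by omega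
      rcases this with h | h <;> simp_all

theorem pm_ncard {n : ℕ} (σ : Equiv.Perm (Fin n)) (u : XS n) :
    (pm σ u).vertsᶜ.ncard = u.vertsᶜ.ncard := by
  have : (pm σ u).vertsᶜ = σ ⁻¹' u.vertsᶜ := rfl
  rw [this, Set.ncard_preimage_of_injective_subset_range σ.injective (by simp)]

theorem kelly_local {n : ℕ} {G H : SimpleGraph (Fin n)} {v w : Fin n} (e : vdel G v ≃g vdel H w) :
    ∃ σ : Equiv.Perm (Fin n), σ v = w ∧
      ∀ a b, a ≠ v → b ≠ v → (H.Adj (σ a) (σ b) ↔ G.Adj a b) := by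
  let e' : {x // x ∈ ({v}ᶜ : Set (Fin n))} ≃ {x // x ∈ ({w}ᶜ : Set (Fin n))} := e.toEquiv
  refine ⟨e'.extendSubtype, ?_, ?_⟩
  · have := e'.extendSubtype_not_mem v (by simp)
    simpa using this
  · intro a b ha hb
    rw [e'.extendSubtype_apply_of_mem a (by simpa using ha),
      e'.extendSubtype_apply_of_mem b (by simpa using hb)]
    exact e.map_rel_iff' (a := ⟨a, by simpa using ha⟩) (b := ⟨b, by simpa using hb⟩)

theorem sum_del {n : ℕ} (a : XS n → ℝ) (h0 : ∀ u : XS n, u.verts = Set.univ → a u = 0) :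
    ∑ u, a u = ∑ v : Fin n, ∑ u : XS n, if v ∉ u.verts then a u / u.vertsᶜ.ncard else 0 := by
  rw [Finset.sum_comm]
  refine Finset.sum_congr rfl fun u _ => ?_
  rw [Finset.sum_ite, Finset.sum_const, Finset.sum_const_zero, add_zero, nsmul_eq_mul]
  have h4 : (Finset.univ.filter (fun v => v ∉ u.verts)).card = u.vertsᶜ.ncard := by
    rw [Set.ncard_eq_toFinset_card']; congr 1; ext; simp
  rw [h4]
  by_cases h : u.verts = Set.univ
  · simp [h0 u h]
  · have : (u.vertsᶜ.ncard : ℝ) ≠ 0 := by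
      rw [Nat.cast_ne_zero, Ne, Set.ncard_eq_zero]
      simpa using h
    field_simp

theorem kelly_s11 {n : ℕ} {G H : SimpleGraph (Fin n)} (hGH : IsReconstruction G H) (a : XS n → ℝ)
    (ha : ∀ σ u, a (pm σ u) = a u) (h0 : ∀ u : XS n, u.verts = Set.univ → a u = 0) :
    ∑ u, a u * iLe G u = ∑ u, a u * iLe H u := by
  obtain ⟨f, hf⟩ := hGH
  rw [sum_del (fun u => a u * iLe G u) (fun u hu => by simp [h0 u hu]),
    sum_del (fun u => a u * iLe H u) (fun u hu => by simp [h0 u hu])]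
  refine Fintype.sum_equiv f _ _ fun v => ?_
  obtain ⟨e⟩ := hf v
  obtain ⟨σ, hσ, hA⟩ := kelly_local e
  symm
  refine Fintype.sum_equiv (pmE σ) _ _ fun u => ?_
  change _ = if v ∉ (pm σ u).verts then a (pm σ u) * iLe G (pm σ u) / ((pm σ u).vertsᶜ.ncard : ℝ) else 0
  rw [pm_ncard, ha]
  have h1 : v ∉ (pm σ u).verts ↔ f v ∉ u.verts := by rw [← hσ]; rfl
  rw [if_congr h1 rfl rfl]
  by_cases h : f v ∉ u.verts
  · rw [if_pos h, if_pos h]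
    rw [← h1] at h
    have : iLe H u = iLe G (pm σ u) := by
      refine if_congr ?_ rfl rfl
      rw [le_toX, le_toX]
      constructor
      · intro h' x y hxy
        rw [← hA x y]
        · exact h' _ _ hxy
        · rintro rfl; exact h hxy.fst_mem
        · rintro rfl; exact h hxy.snd_mem
      · intro h' x y hxy
        have hxy' : (pm σ u).Adj (σ.symm x) (σ.symm y) := by simpa [pm] using hxy
        have := (hA (σ.symm x) (σ.symm y) ?_ ?_).2 (h' _ _ hxy')
        · simpa using this
        · intro hh; rw [hh] at hxy'; exact h hxy'.fst_mem
        · intro hh; rw [hh] at hxy'; exact h hxy'.snd_mem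
    rw [this]
  · rw [if_neg h, if_neg h]

def Good (n : ℕ) (L : GSeq) : Prop := ∀ F ∈ L, F.1 ≤ n - 1

theorem isoTo_card {n : ℕ} {F : Σ k : ℕ, SimpleGraph (Fin k)} {u : XS n} (h : IsoTo F u) :
    F.1 = u.verts.ncard := by
  obtain ⟨e⟩ := h
  have := Nat.card_congr e.toEquiv
  rw [Nat.card_eq_fintype_card, Fintype.card_fin] at this
  rw [this]; rfl

theorem sN_recon {n : ℕ} (hn : 1 ≤ n) {G H : SimpleGraph (Fin n)} (hGH : IsReconstruction G H)
    (F : Σ k : ℕ, SimpleGraph (Fin k)) (hF : F.1 ≤ n - 1) : sN F G = sN F H := by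
  have := kelly_s11 hGH (fun u => if IsoTo F u then 1 else 0) (fun σ u => if_congr (isoTo_pm F σ u) rfl rfl) ?_
  · simpa [sN, ite_mul] using this
  · intro u hu
    rw [if_neg]
    intro h
    have := isoTo_card h
    rw [hu, Set.ncard_univ, Nat.card_eq_fintype_card, Fintype.card_fin] at this
    omega

theorem NN_recon {n : ℕ} (hn : 1 ≤ n) {G H : SimpleGraph (Fin n)} (hGH : IsReconstruction G H)
    (L : GSeq) (hL : Good n L) : NN L G = NN L H := by
  induction L with
  | nil => simp [NN_nil]
  | cons F L ih =>
    rw [NN_cons, NN_cons, ih (fun F hF => hL F (by simp [hF])),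
      sN_recon hn hGH F (hL F (by simp))]

theorem Z_recon {n : ℕ} (hn : 1 ≤ n) {G H : SimpleGraph (Fin n)} (hGH : IsReconstruction G H)
    (L : GSeq) (hL : Good n L) : Zt 0 L G = Zt 0 L H := by
  have key : ∀ G : SimpleGraph (Fin n), Zt 0 L G = NN L G -
      ∑ u, (if u.vertsᶜ.ncard = 0 then 0 else cc L u) * iLe G u := by
    intro G
    rw [Zt, NN, Sf_eq, Sf_eq, ← Finset.sum_sub_distrib]
    refine Finset.sum_congr rfl fun u _ => ?_
    split_ifs <;> ring
  rw [key, key, NN_recon hn hGH L hL]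
  congr 1
  refine kelly_s11 hGH _ ?_ ?_
  · intro σ u; rw [pm_ncard, cc_pm]
  · intro u hu; simp [hu]

/-- zeta transform -/
noncomputable def zet (m : ℕ) : (SimpleGraph (Fin m) → ℝ) →ₗ[ℝ] (SimpleGraph (Fin m) → ℝ) where
  toFun b G := ∑ H, if H ≤ G then b H else 0
  map_add' b c := by
    ext G; simp only [Pi.add_apply, ← Finset.sum_add_distrib]
    refine Finset.sum_congr rfl fun u _ => ?_
    split_ifs <;> simp
  map_smul' r c := by
    ext G; simp only [Pi.smul_apply, RingHom.id_apply, smul_eq_mul, Finset.mul_sum]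
    refine Finset.sum_congr rfl fun u _ => ?_
    split_ifs <;> simp

theorem zet_apply (m : ℕ) (b : SimpleGraph (Fin m) → ℝ) (G) :
    zet m b G = ∑ H, if H ≤ G then b H else 0 := rfl

theorem zet_inj (m : ℕ) : Function.Injective (zet m) := by
  rw [injective_iff_map_eq_zero]
  intro b hb
  ext G
  induction G using (inferInstance : WellFoundedLT (SimpleGraph (Fin m))).induction with
  | ind G ih =>
    have h := congrFun hb G
    rw [zet_apply, Finset.sum_eq_single G] at h
    · simpa using h
    · intro H _ hne
      split_ifs with hle
      · exact ih H (lt_of_le_of_ne hle hne)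
      · rfl
    · simp

theorem iSup_fin_succ' {α : Type*} [CompleteLattice α] {k : ℕ} (C : Fin (k+1) → α) :
    (⨆ i, C i) = C 0 ⊔ ⨆ i : Fin k, C i.succ := by
  apply le_antisymm
  · refine iSup_le fun i => ?_
    refine Fin.cases ?_ (fun j => ?_) i
    · exact le_sup_left
    · exact le_sup_of_le_right (le_iSup (fun i : Fin k => C i.succ) j)
  · exact sup_le (le_iSup C 0) (iSup_le fun i => le_iSup C i.succ)

theorem Sf_tuple {n : ℕ} (L : GSeq) : ∀ (φ : XS n → ℝ),
    Sf L φ = ∑ C : Fin L.length → XS n, if ∀ i, IsoTo (L.get i) (C i) then φ (⨆ i, C i) else 0 := by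
  induction L with
  | nil =>
    intro φ
    have : ∀ C : Fin (List.length ([] : GSeq)) → XS n, (⨆ i, C i) = ⊥ := by
      intro C
      have : IsEmpty (Fin (List.length ([] : GSeq))) := inferInstanceAs (IsEmpty (Fin 0))
      simp
    have h2 : ∀ C : Fin (List.length ([] : GSeq)) → XS n,
        (∀ i, IsoTo (([] : GSeq).get i) (C i)) := fun C i => Fin.elim0 i
    simp only [this, Sf_nil]
    rw [Finset.sum_congr rfl (fun C _ => if_pos (h2 C))]
    simp
  | cons F L ih =>
    intro φ
    rw [Sf_cons]
    change _ = ∑ C : Fin (L.length + 1) → XS n, _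
    rw [← Equiv.sum_comp (Fin.consEquiv (fun _ => XS n)), Fintype.sum_prod_type]
    refine Finset.sum_congr rfl fun x _ => ?_
    rw [ih]
    split_ifs with hx
    · refine Finset.sum_congr rfl fun C _ => ?_
      refine if_congr ?_ ?_ rfl
      · exact ⟨fun h i => Fin.cases (motive := fun i : Fin (L.length + 1) =>
            IsoTo ((F :: L).get i) ((Fin.consEquiv fun _ => XS n) (x, C) i)) hx h i,
          fun h i => h (Fin.succ i)⟩
      · exact congrArg φ (iSup_fin_succ' ((Fin.consEquiv fun _ => XS n) (x, C))).symm
    · symm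
      refine Finset.sum_eq_zero fun C _ => if_neg ?_
      intro h
      exact hx (h 0)

def up {n : ℕ} {H : SimpleGraph (Fin n)} (u : H.Subgraph) : XS n where
  verts := u.verts
  Adj := u.Adj
  adj_sub h := h.ne
  edge_vert h := u.edge_vert h
  symm := u.symm

def down {n : ℕ} (H : SimpleGraph (Fin n)) (u : XS n) (h : u ≤ toX H) : H.Subgraph where
  verts := u.verts
  Adj := u.Adj
  adj_sub h' := h.2 h'
  edge_vert h := u.edge_vert h
  symm := u.symm

theorem up_inj {n : ℕ} {H : SimpleGraph (Fin n)} : Function.Injective (up (H := H)) := by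
  intro u v h
  ext a b
  · exact iff_of_eq (congrArg (fun w : XS n => a ∈ w.verts) h)
  · exact iff_of_eq (congrArg (fun w : XS n => w.Adj a b) h)

theorem up_iSup {n : ℕ} {H : SimpleGraph (Fin n)} {k : ℕ} (C : Fin k → H.Subgraph) :
    up (⨆ i, C i) = ⨆ i, up (C i) := by
  ext a b
  · simp [up]
  · simp [up]

theorem coverCount_eq {n : ℕ} (L : GSeq) (H : SimpleGraph (Fin n)) :
    (coverCount L H : ℝ) = cc L (toX H) := by
  have h1 : coverCount L H = Nat.card {C : Fin L.length → XS n //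
      (∀ i, IsoTo (L.get i) (C i)) ∧ (⨆ i, C i) = toX H} := by
    refine Nat.card_eq_of_bijective (fun C => ⟨fun i => up (C.1 i), fun i => C.2.1 i, ?_⟩) ⟨?_, ?_⟩
    · rw [← up_iSup, C.2.2]; rfl
    · intro C C' h
      have h := congrArg Subtype.val h
      ext1; ext1 i
      exact up_inj (congrFun h i)
    · rintro ⟨C, hC, hs⟩
      have hle : ∀ i, C i ≤ toX H := fun i => hs ▸ le_iSup C i
      refine ⟨⟨fun i => down H (C i) (hle i), fun i => hC i, ?_⟩, rfl⟩
      apply up_inj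
      rw [up_iSup]
      exact hs
  rw [h1, cc, Sf_tuple, Nat.card_eq_fintype_card, Fintype.card_subtype, ← Finset.sum_boole]
  refine Finset.sum_congr rfl fun C _ => ?_
  simp only [dl, ite_and]

theorem iso_perm {n : ℕ} {G H : SimpleGraph (Fin n)} (e : G ≃g H) : pm e.toEquiv (toX H) = toX G := by
  ext a b
  · simp [pm, toX]
  · exact e.map_rel_iff'

theorem coverCount_iso {n : ℕ} (L : GSeq) {G H : SimpleGraph (Fin n)} (e : G ≃g H) :
    (coverCount L G : ℝ) = coverCount L H := by
  rw [coverCount_eq, coverCount_eq, ← iso_perm e, cc_pm]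

theorem zet_cover {n : ℕ} (L : GSeq) :
    zet n (fun H => (coverCount L H : ℝ)) = Zt 0 L := by
  ext G
  rw [zet_apply, Zt]
  have : (fun u : XS n => if u.vertsᶜ.ncard = 0 then iLe G u else 0) =
      ∑ H : SimpleGraph (Fin n), if H ≤ G then dl (toX H) else 0 := by
    ext u
    rw [Finset.sum_apply]
    have hv : u.vertsᶜ.ncard = 0 ↔ u.verts = Set.univ := by
      rw [Set.ncard_eq_zero]; simp
    by_cases h : u.verts = Set.univ
    · have hu : u = toX u.spanningCoe := by
        ext a b
        · simp [h, toX]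
        · simp [toX]
      rw [if_pos (hv.2 h), Finset.sum_eq_single u.spanningCoe]
      · have : u.spanningCoe ≤ G ↔ u ≤ toX G := by
          rw [le_toX]; rfl
        rw [iLe]
        simp only [this]
        split_ifs
        · rw [dl, if_pos hu]
        · rfl
      · intro H _ hne
        split_ifs
        · rw [dl, if_neg]
          intro h'
          apply hne
          rw [hu] at h'
          exact (toX_inj h').symm
        · rfl
      · simp
    · rw [if_neg (fun h' => h (hv.1 h'))]
      symm
      refine Finset.sum_eq_zero fun H _ => ?_
      split_ifs
      · rw [dl, if_neg]
        rintro rfl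
        exact h rfl
      · rfl
  rw [this, map_sum]
  refine Finset.sum_congr rfl fun H _ => ?_
  split_ifs
  · rw [coverCount_eq]; rfl
  · simp


abbrev gd {m : ℕ} (G : SimpleGraph (Fin (m+1))) (v : Fin (m+1)) : SimpleGraph (Fin m) :=
  G.comap v.succAbove

def gdIso {m : ℕ} (G : SimpleGraph (Fin (m+1))) (v : Fin (m+1)) : gd G v ≃g vdel G v where
  toEquiv := finSuccAboveEquiv v
  map_rel_iff' := Iff.rfl

def embX {m : ℕ} (v : Fin (m+1)) (P : SimpleGraph (Fin m)) : XS (m+1) where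
  verts := {x | x ≠ v}
  Adj a b := ∃ i j, P.Adj i j ∧ v.succAbove i = a ∧ v.succAbove j = b
  adj_sub := by
    rintro a b ⟨i, j, h, rfl, rfl⟩
    simpa using h.ne
  edge_vert := by
    rintro a b ⟨i, j, h, rfl, rfl⟩
    exact Fin.succAbove_ne v i
  symm := ⟨by
    rintro a b ⟨i, j, h, rfl, rfl⟩
    exact ⟨j, i, h.symm, rfl, rfl⟩⟩

theorem embX_adj {m : ℕ} (v : Fin (m+1)) (P : SimpleGraph (Fin m)) (i j : Fin m) :
    (embX v P).Adj (v.succAbove i) (v.succAbove j) ↔ P.Adj i j := by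
  constructor
  · rintro ⟨i', j', h, h1, h2⟩
    rw [Fin.succAbove_right_inj] at h1 h2
    rwa [← h1, ← h2]
  · intro h; exact ⟨i, j, h, rfl, rfl⟩

def embIso {m : ℕ} (v : Fin (m+1)) (P : SimpleGraph (Fin m)) : P ≃g (embX v P).coe where
  toEquiv := finSuccAboveEquiv v
  map_rel_iff' := by
    intro i j
    exact embX_adj v P i j

theorem embX_le {m : ℕ} (v : Fin (m+1)) (P : SimpleGraph (Fin m)) (G) :
    embX v P ≤ toX G ↔ P ≤ gd G v := by
  rw [le_toX]
  constructor
  · intro h i j hij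
    exact h _ _ ⟨i, j, hij, rfl, rfl⟩
  · rintro h a b ⟨i, j, hij, rfl, rfl⟩
    exact h hij

theorem embX_inj {m : ℕ} (v : Fin (m+1)) : Function.Injective (embX v) := by
  intro P Q h
  ext i j
  rw [← embX_adj v P, ← embX_adj v Q, h]

theorem embX_surj {m : ℕ} (v : Fin (m+1)) (u : XS (m+1)) (hu : u.verts = {v}ᶜ) :
    ∃ P, embX v P = u := by
  refine ⟨u.spanningCoe.comap v.succAbove, ?_⟩
  ext a b
  · rw [hu]; rfl
  · constructor
    · rintro ⟨i, j, h, rfl, rfl⟩; exact h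
    · intro h
      have ha : a ∈ u.verts := h.fst_mem
      have hb : b ∈ u.verts := h.snd_mem
      rw [hu] at ha hb
      obtain ⟨i, rfl⟩ := Fin.exists_succAbove_eq ha
      obtain ⟨j, rfl⟩ := Fin.exists_succAbove_eq hb
      exact ⟨i, j, h, rfl, rfl⟩

noncomputable def indc {m : ℕ} (P : SimpleGraph (Fin m)) : SimpleGraph (Fin m) → ℝ :=
  fun Q => if Nonempty (P ≃g Q) then 1 else 0

theorem isoTo_compl {m : ℕ} {P : SimpleGraph (Fin m)} {u : XS (m+1)} (h : IsoTo ⟨m, P⟩ u) :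
    u.vertsᶜ.ncard = 1 := by
  have h1 := isoTo_card h
  have h2 := Set.ncard_add_ncard_compl u.verts
  rw [Nat.card_eq_fintype_card, Fintype.card_fin] at h2
  simp only at h1
  omega

theorem sN_gd {m : ℕ} (P : SimpleGraph (Fin m)) (G : SimpleGraph (Fin (m+1))) :
    sN ⟨m, P⟩ G = ∑ v, zet m (indc P) (gd G v) := by
  rw [sN, sum_del]
  · refine Finset.sum_congr rfl fun v _ => ?_
    rw [zet_apply]
    symm
    refine Finset.sum_of_injOn (embX v) (embX_inj v).injOn (by simp) ?_ ?_
    · intro u _ hu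
      by_cases h1 : v ∉ u.verts
      swap
      · rw [if_neg h1]
      by_cases h2 : IsoTo ⟨m, P⟩ u
      · exfalso
        apply hu
        have := isoTo_compl h2
        rw [Set.ncard_eq_one] at this
        obtain ⟨w, hw⟩ := this
        have hvw : v ∈ u.vertsᶜ := h1
        rw [hw] at hvw
        obtain rfl : v = w := hvw
        obtain ⟨Q, hQ⟩ := embX_surj v u (by rw [← hw, compl_compl])
        exact ⟨Q, by simp, hQ⟩
      · rw [if_neg h2]; simp
    · intro Q _
      have h1 : v ∉ (embX v Q).verts := fun h => h rfl
      have h2 : IsoTo ⟨m, P⟩ (embX v Q) ↔ Nonempty (P ≃g Q) :=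
        ⟨fun ⟨e⟩ => ⟨e.trans (embIso v Q).symm⟩, fun ⟨e⟩ => ⟨e.trans (embIso v Q)⟩⟩
      have h3 : (embX v Q).vertsᶜ.ncard = 1 := isoTo_compl (P := Q) ⟨embIso v Q⟩
      rw [if_pos h1, h3, if_congr h2 rfl rfl, iLe, if_congr (embX_le v Q G) rfl rfl, indc]
      split_ifs <;> simp
  · intro u hu
    rw [if_neg]
    intro h
    have := isoTo_compl h
    simp [hu] at this

def isoS (m : ℕ) : Setoid (SimpleGraph (Fin m)) where
  r P Q := Nonempty (P ≃g Q)
  iseqv := ⟨fun _ => ⟨Iso.refl⟩, fun ⟨e⟩ => ⟨e.symm⟩, fun ⟨e⟩ ⟨f⟩ => ⟨e.trans f⟩⟩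

def invS (m : ℕ) : Submodule ℝ (SimpleGraph (Fin m) → ℝ) where
  carrier := {b | ∀ P Q, Nonempty (P ≃g Q) → b P = b Q}
  add_mem' := by
    intro a b ha hb P Q h
    simp [ha P Q h, hb P Q h]
  zero_mem' := by intro P Q _; rfl
  smul_mem' := by
    intro c a ha P Q h
    simp [ha P Q h]

theorem indc_mem {m : ℕ} (P : SimpleGraph (Fin m)) : indc P ∈ invS m := by
  rintro Q Q' ⟨e⟩
  exact if_congr ⟨fun ⟨f⟩ => ⟨f.trans e⟩, fun ⟨f⟩ => ⟨f.trans e.symm⟩⟩ rfl rfl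

theorem inv_eq {m : ℕ} (b : SimpleGraph (Fin m) → ℝ) (hb : b ∈ invS m) :
    b = ∑ c : Quotient (isoS m), b c.out • indc c.out := by
  ext P
  rw [Finset.sum_apply, Finset.sum_eq_single (Quotient.mk (isoS m) P)]
  · have : Nonempty ((Quotient.mk (isoS m) P).out ≃g P) := Quotient.mk_out (s := isoS m) P
    rw [Pi.smul_apply, indc, if_pos this, hb _ _ this]; simp
  · intro c _ hc
    rw [Pi.smul_apply, indc, if_neg, smul_zero]
    intro h
    apply hc
    rw [← Quotient.out_eq c]
    exact Quotient.sound (s := isoS m) h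
  · simp

theorem zet_inv {m : ℕ} (b : SimpleGraph (Fin m) → ℝ) (hb : b ∈ invS m) : zet m b ∈ invS m := by
  rintro P Q ⟨e⟩
  rw [zet_apply, zet_apply]
  refine Fintype.sum_equiv (Equiv.simpleGraph e.toEquiv) _ _ fun H => ?_
  have h1 : Nonempty (H ≃g Equiv.simpleGraph e.toEquiv H) :=
    ⟨⟨e.toEquiv, by
      intro a b
      change H.Adj (e.toEquiv.symm (e.toEquiv a)) (e.toEquiv.symm (e.toEquiv b)) ↔ _
      rw [Equiv.symm_apply_apply, Equiv.symm_apply_apply]⟩⟩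
  refine if_congr ?_ (hb _ _ h1) rfl
  constructor
  · intro h a b hab
    have : P.Adj (e.symm a) (e.symm b) := h hab
    have := e.map_rel_iff'.2 this
    simpa using this
  · intro h a b hab
    apply e.map_rel_iff'.1
    apply h
    change H.Adj (e.toEquiv.symm (e.toEquiv a)) (e.toEquiv.symm (e.toEquiv b))
    rwa [Equiv.symm_apply_apply, Equiv.symm_apply_apply]

theorem separation {m : ℕ} (G H : SimpleGraph (Fin (m+1)))
    (h : ∀ P : SimpleGraph (Fin m), sN ⟨m, P⟩ G = sN ⟨m, P⟩ H) : IsReconstruction G H := by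
  have h1 : ∀ b ∈ invS m, ∑ v, zet m b (gd G v) = ∑ v, zet m b (gd H v) := by
    intro b hb
    have key : ∀ G : SimpleGraph (Fin (m+1)), ∑ v, zet m b (gd G v) =
        ∑ c : Quotient (isoS m), b c.out * sN ⟨m, c.out⟩ G := by
      intro G
      conv_lhs => rw [inv_eq b hb]
      simp only [map_sum, map_smul, Finset.sum_apply, Pi.smul_apply, smul_eq_mul]
      rw [Finset.sum_comm]
      simp only [sN_gd, Finset.mul_sum]
    rw [key, key]
    simp only [h]
  let z : invS m →ₗ[ℝ] invS m := (zet m).restrict zet_inv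
  have hz : Function.Injective z := by
    intro a b hab
    apply Subtype.ext
    exact zet_inj m (congrArg Subtype.val hab)
  have hz' : Function.Surjective z := LinearMap.injective_iff_surjective.1 hz
  have h2 : ∀ P : SimpleGraph (Fin m), ∑ v, indc P (gd G v) = ∑ v, indc P (gd H v) := by
    intro P
    obtain ⟨b, hb⟩ := hz' ⟨indc P, indc_mem P⟩
    have hb : zet m b.1 = indc P := congrArg Subtype.val hb
    rw [← hb]
    exact h1 b.1 b.2
  let q (G : SimpleGraph (Fin (m+1))) (v : Fin (m+1)) : Quotient (isoS m) := Quotient.mk _ (gd G v)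
  have h3 : ∀ (G : SimpleGraph (Fin (m+1))) (c : Quotient (isoS m)),
      (Fintype.card {v // q G v = c} : ℝ) = ∑ v, indc c.out (gd G v) := by
    intro G c
    rw [Fintype.card_subtype, ← Finset.sum_boole]
    refine Finset.sum_congr rfl fun v _ => if_congr ?_ rfl rfl
    conv_lhs => rw [← Quotient.out_eq c]
    constructor
    · intro h; exact (isoS m).symm (Quotient.exact h)
    · intro h; exact Quotient.sound ((isoS m).symm h)
  have h4 : ∀ c, Nonempty ({v // q G v = c} ≃ {v // q H v = c}) := by
    intro c
    refine ⟨Fintype.equivOfCardEq ?_⟩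
    have := (h3 G c).trans ((h2 _).trans (h3 H c).symm)
    exact_mod_cast this
  let f : Fin (m+1) ≃ Fin (m+1) := (Equiv.sigmaFiberEquiv (q G)).symm.trans
    ((Equiv.sigmaCongrRight (fun c => (h4 c).some)).trans (Equiv.sigmaFiberEquiv (q H)))
  refine ⟨f, fun v => ?_⟩
  have h5 : q H (f v) = q G v := ((h4 (q G v)).some ⟨v, rfl⟩).2
  obtain ⟨e⟩ : Nonempty (gd H (f v) ≃g gd G v) := Quotient.exact h5
  exact ⟨(gdIso G v).symm.trans (e.symm.trans (gdIso H (f v)))⟩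

theorem recon_refl {n : ℕ} (G : SimpleGraph (Fin n)) : IsReconstruction G G :=
  ⟨Equiv.refl _, fun _ => ⟨Iso.refl⟩⟩

def KZ (n : ℕ) : Submodule ℝ (SimpleGraph (Fin n) → ℝ) :=
  Submodule.span ℝ {f | ∃ L, Good n L ∧ f = Zt 0 L}

theorem Zt_mem {n : ℕ} (hn : 2 ≤ n) (t : ℕ) : ∀ L, Good n L → Zt t L ∈ KZ n := by
  induction t with
  | zero => intro L hL; exact Submodule.subset_span ⟨L, hL, rfl⟩
  | succ t ih =>
    intro L hL
    have hL' : Good n (K1 :: L) := by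
      intro F hF
      rcases List.mem_cons.1 hF with rfl | hF
      · change 1 ≤ n - 1; omega
      · exact hL F hF
    have : Zt (t+1) L = ((t : ℝ) + 1)⁻¹ • (Zt t (K1 :: L) - ((n : ℝ) - t) • Zt (n := n) t L) := by
      ext G
      simp only [Pi.smul_apply, Pi.sub_apply, smul_eq_mul, Zt_K1]
      have : (t : ℝ) + 1 ≠ 0 := by positivity
      field_simp
      ring
    rw [this]
    exact Submodule.smul_mem _ _ (Submodule.sub_mem _ (ih _ hL') (Submodule.smul_mem _ _ (ih _ hL)))

def KN (n : ℕ) : Submodule ℝ (SimpleGraph (Fin n) → ℝ) :=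
  Submodule.span ℝ {f | ∃ L, Good n L ∧ f = NN L}

theorem KN_le {n : ℕ} (hn : 2 ≤ n) : KN n ≤ KZ n := by
  refine Submodule.span_le.2 ?_
  rintro _ ⟨L, hL, rfl⟩
  have : NN L = ∑ t ∈ Finset.range (n+1), Zt (n := n) t L := by
    ext G; rw [NN_eq, Finset.sum_apply]
  rw [this]
  exact Submodule.sum_mem _ fun t _ => Zt_mem hn t L hL

theorem KN_mul {n : ℕ} (F : Σ k : ℕ, SimpleGraph (Fin k)) (hF : F.1 ≤ n - 1)
    (p : SimpleGraph (Fin n) → ℝ) (hp : p ∈ KN n) : sN F * p ∈ KN n := by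
  induction hp using Submodule.span_induction with
  | mem p hp =>
    obtain ⟨L, hL, rfl⟩ := hp
    refine Submodule.subset_span ⟨F :: L, ?_, ?_⟩
    · intro F' hF'
      rcases List.mem_cons.1 hF' with rfl | h
      · exact hF
      · exact hL _ h
    · ext G; rw [NN_cons]; rfl
  | zero => simp
  | add x y _ _ hx hy => rw [mul_add]; exact Submodule.add_mem _ hx hy
  | smul c x _ hx => rw [mul_smul_comm]; exact Submodule.smul_mem _ _ hx

theorem exists_sep {n : ℕ} (hn : 2 ≤ n) (G : SimpleGraph (Fin n)) (T : Finset (SimpleGraph (Fin n)))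
    (hT : ∀ H ∈ T, ¬ IsReconstruction G H) : ∃ p ∈ KN n, p G ≠ 0 ∧ ∀ H ∈ T, p H = 0 := by
  induction T using Finset.induction_on with
  | empty =>
    refine ⟨NN [], Submodule.subset_span ⟨[], ?_, rfl⟩, ?_, ?_⟩
    · intro F hF; simp at hF
    · simp [NN_nil]
    · simp
  | insert H T _ ih =>
    obtain ⟨p, hp, h1, h2⟩ := ih fun H' h => hT H' (Finset.mem_insert_of_mem h)
    obtain ⟨F, hF, hne⟩ : ∃ F : Σ k : ℕ, SimpleGraph (Fin k), F.1 ≤ n - 1 ∧ sN F G ≠ sN F H := by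
      by_contra hcon
      push Not at hcon
      obtain ⟨m, rfl⟩ : ∃ m, n = m + 1 := ⟨n - 1, by omega⟩
      exact hT H (Finset.mem_insert_self _ _) (separation G H fun P => hcon ⟨m, P⟩ (by simp))
    refine ⟨sN F * p - sN F H • p, Submodule.sub_mem _ (KN_mul F hF p hp) (Submodule.smul_mem _ _ hp), ?_, ?_⟩
    · simp only [Pi.sub_apply, Pi.mul_apply, Pi.smul_apply, smul_eq_mul]
      rw [← sub_mul]
      exact mul_ne_zero (sub_ne_zero.2 hne) h1
    · intro H' hH'
      simp only [Pi.sub_apply, Pi.mul_apply, Pi.smul_apply, smul_eq_mul]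
      rcases Finset.mem_insert.1 hH' with rfl | h
      · ring
      · rw [h2 _ h]; ring

theorem KZ_recon {n : ℕ} (hn : 2 ≤ n) {G H : SimpleGraph (Fin n)} (h : IsReconstruction G H)
    (p : SimpleGraph (Fin n) → ℝ) (hp : p ∈ KZ n) : p G = p H := by
  induction hp using Submodule.span_induction with
  | mem p hp =>
    obtain ⟨L, hL, rfl⟩ := hp
    exact Z_recon (by omega) h L hL
  | zero => rfl
  | add x y _ _ hx hy => simp [hx, hy]
  | smul c x _ hx => simp [hx]

theorem finrank_KZ {n : ℕ} (hn : 2 ≤ n) (D : Finset (SimpleGraph (Fin n)))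
    (hD : IsReconTransversal Set.univ D) : Module.finrank ℝ (KZ n) = D.card := by
  let ρ : KZ n →ₗ[ℝ] (D → ℝ) :=
    (LinearMap.funLeft ℝ ℝ (Subtype.val : D → SimpleGraph (Fin n))).domRestrict (KZ n)
  have hinj : Function.Injective ρ := by
    rw [injective_iff_map_eq_zero]
    rintro ⟨p, hp⟩ h0
    apply Subtype.ext
    ext G
    obtain ⟨H, ⟨hH, hGH⟩, _⟩ := hD.2 G trivial
    change p G = 0
    rw [KZ_recon hn hGH p hp]
    exact congrFun h0 ⟨H, hH⟩
  have hsurj : Function.Surjective ρ := by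
    rw [← LinearMap.range_eq_top, eq_top_iff]
    have hs : ∀ G : D, Pi.single G (1 : ℝ) ∈ LinearMap.range ρ := by
      rintro ⟨G, hG⟩
      obtain ⟨p, hp, h1, h2⟩ := exists_sep hn G (D.erase G) (by
        intro H hH hr
        obtain ⟨H', _, hu⟩ := hD.2 G trivial
        have e1 := hu H ⟨Finset.mem_of_mem_erase hH, hr⟩
        have e2 := hu G ⟨hG, recon_refl G⟩
        exact Finset.ne_of_mem_erase hH (e1.trans e2.symm))
      refine ⟨(p G)⁻¹ • ⟨p, KN_le hn hp⟩, ?_⟩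
      ext ⟨H, hH⟩
      change (p G)⁻¹ * p H = _
      by_cases h : H = G
      · subst h
        rw [Pi.single_eq_same]; field_simp
      · rw [h2 H (Finset.mem_erase.2 ⟨h, hH⟩), Pi.single_eq_of_ne, mul_zero]
        intro h'; exact h (congrArg Subtype.val h')
    intro x _
    have : x = ∑ G : D, x G • Pi.single G (1 : ℝ) := by
      ext G; simp [Finset.sum_apply, Pi.single_apply]
    rw [this]
    exact Submodule.sum_mem _ fun G _ => Submodule.smul_mem _ _ (hs G)
  rw [(LinearEquiv.ofBijective ρ ⟨hinj, hsurj⟩).finrank_eq]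
  simp

theorem finrank_rows {n : ℕ} (R : Finset (SimpleGraph (Fin n))) (hR : IsIsoTransversal Set.univ R) :
    Module.finrank ℝ (Submodule.span ℝ {f : R → ℝ | ∃ L, Good n L ∧
      f = fun H : R => (coverCount L (H : SimpleGraph (Fin n)) : ℝ)}) = Module.finrank ℝ (KZ n) := by
  have hex : ∀ G : SimpleGraph (Fin n), ∃ H : R, Nonempty (G ≃g H.1) := by
    intro G
    obtain ⟨H, ⟨h1, h2⟩, _⟩ := hR.2 G trivial
    exact ⟨⟨H, h1⟩, h2⟩
  choose rep hrep using hex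
  have hsurj : Function.Surjective rep := by
    intro H
    refine ⟨H.1, ?_⟩
    obtain ⟨H', _, hu⟩ := hR.2 H.1 trivial
    apply Subtype.ext
    exact (hu _ ⟨(rep H.1).2, hrep H.1⟩).trans (hu _ ⟨H.2, ⟨Iso.refl⟩⟩).symm
  let Φ : (R → ℝ) →ₗ[ℝ] (SimpleGraph (Fin n) → ℝ) := (zet n).comp (LinearMap.funLeft ℝ ℝ rep)
  have hΦ : Function.Injective Φ :=
    (zet_inj n).comp (LinearMap.funLeft_injective_of_surjective ℝ ℝ rep hsurj)
  have hrow : ∀ L, Φ (fun H : R => (coverCount L (H : SimpleGraph (Fin n)) : ℝ)) = Zt 0 L := by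
    intro L
    rw [← zet_cover]
    change zet n _ = zet n _
    congr 1
    ext G
    obtain ⟨e⟩ := hrep G
    exact (coverCount_iso L e).symm
  rw [(Submodule.equivMapOfInjective Φ hΦ _).finrank_eq, Submodule.map_span]
  have : Φ '' {f : R → ℝ | ∃ L, Good n L ∧
      f = fun H : R => (coverCount L (H : SimpleGraph (Fin n)) : ℝ)} =
      {f | ∃ L, Good n L ∧ f = Zt 0 L} := by
    ext f
    constructor
    · rintro ⟨_, ⟨L, hL, rfl⟩, rfl⟩
      exact ⟨L, hL, hrow L⟩
    · rintro ⟨L, hL, rfl⟩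
      exact ⟨_, ⟨L, hL, rfl⟩, hrow L⟩
  rw [this]
  rfl

end Aux

/-- Let `n ≥ 3`. Then there is a finite family `𝔉 = (L_1, …, L_l)` of sequences
of graphs, each graph having at most `n − 1` vertices, such that the matrix of
covering numbers `c(L_i, H)` — rows indexed by `Fin l`, columns indexed by the
isomorphism classes of `n`-vertex graphs (a transversal `R` of all `n`-vertex
graphs) — has rank `d(n) = D.card` over `ℝ`, for `D` any transversal of the
reconstruction classes of `n`-vertex graphs. -/
theorem stmt_11 {n : ℕ} (hn : 3 ≤ n)
    (R : Finset (SimpleGraph (Fin n))) (hR : IsIsoTransversal Set.univ R)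
    (D : Finset (SimpleGraph (Fin n))) (hD : IsReconTransversal Set.univ D) :
    ∃ (l : ℕ) (𝔉 : Fin l → GSeq),
      (∀ i : Fin l, ∀ F ∈ 𝔉 i, F.1 ≤ n - 1) ∧
      (Matrix.of fun (i : Fin l) (H : ↥R) =>
          ((coverCount (𝔉 i) (H : SimpleGraph (Fin n)) : ℝ))).rank = D.card := by
  obtain ⟨f, hf, hspan, _⟩ := Submodule.exists_fun_fin_finrank_span_eq ℝ
    {f : R → ℝ | ∃ L, Good n L ∧ f = fun H : R => (coverCount L (H : SimpleGraph (Fin n)) : ℝ)}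
  choose 𝔉 h1 h2 using hf
  refine ⟨_, 𝔉, h1, ?_⟩
  rw [Matrix.rank_eq_finrank_span_row, ← finrank_KZ (by omega) D hD, ← finrank_rows R hR]
  have h3 : (Matrix.of fun i (H : ↥R) =>
      ((coverCount (𝔉 i) (H : SimpleGraph (Fin n)) : ℝ))).row = f := by
    funext i
    exact (h2 i).symm
  rw [h3]
  exact congrArg (fun S : Submodule ℝ (R → ℝ) => Module.finrank ℝ S) hspan
end
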